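/- arXiv:1710.10559 — 19 statements merged into one kernel-verified Lean document; each statement's English description precedes it below -/
import Mathlib

section
/- Let A be an implication zroupoid satisfying the identity x' → y ≈ x → y' (for all x, y in A). Then A satisfies the identity (x → y) → y' ≈ x → y' (for all x, y in A). -/
/-- In any implication zroupoid satisfying x' → y ≈ x → y',
    the identity (x → y) → y' ≈ x → y' holds. Here x' := x → 0. -/
theorem stmt_0 {A : Type*} (i : A → A → A) (o : A)
    (hI : ∀ x y z : A, i (i x y) z = i (i (i (i z o) x) (i (i y z) o)) o)
    (h0 : i (i o o) o = o)
    (h : ∀ x y : A, i (i x o) y = i x (i y o)) :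
    ∀ x y : A, i (i x y) (i y o) = i x (i y o) := by
  have contract (x y z) : i (i (i x (i y o)) (i (i z x) o)) o = i (i y z) x := by
    rw [← h x y, ← hI]
  have oo_aux : i o (i o o) = o := by rw [← h, h0]
  have move_aux (x y) : i (i x (i o o)) y = i x (i y (i o o)) := by
    rw [← h x o, h, h, h y o]
  have o_aux (x) : i o (i x (i o o)) = i o x := by rw [← move_aux, oo_aux]
  -- (0 → x) → 0 = x → 0
  have prime_o_imp (x) : i (i o x) o = i x o := calc
    i (i o x) o = i (i o x) (i o (i o o)) := by rw [oo_aux]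
    _ = i (i (i o (i x (i o o))) (i o o)) o := by rw [← move_aux, o_aux]
    _ = i (i (i (i o o) (i x o)) (i (i o (i o o)) o)) o := by
      rw [← h x o, ← h o (i x o), oo_aux]
    _ = i (i x o) (i o o) := contract _ _ _
    _ = i x o := by rw [h, h, oo_aux]
  have oo : i o o = o := by
    rw [← prime_o_imp, h, oo_aux]
  have prime_prime (x) : i (i x o) o = i x o := by rw [h, oo]
  have o_prime (x) : i o (i x o) = i o x := by rw [← h, oo]
  have o_imp_left (x y z) : i (i (i o x) y) z = i (i x y) z := by
    rw [← contract z (i o x) y, prime_o_imp, contract]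
  -- priming the middle variable of (x → y) → z has no effect
  have prime_middle (x y z) : i (i x (i y o)) z = i (i x y) z := by
    rw [← h, ← o_imp_left (i x o), o_prime, o_imp_left]
  have rotate_prime (x y z) : i (i (i x y) (i z x)) o = i (i y (i o z)) x := by
    rw [← contract x y (i o z), o_imp_left, prime_middle x y, prime_middle (i x y)]
  have o_o_imp (x) : i o (i o x) = i o x := by
    rw [← o_prime (i o x), prime_o_imp, o_prime]
  have imp_imp_self_prime (x y) : i (i x (i y x)) o = i (i o y) x := calc
    i (i x (i y x)) o = i (i x (i (i y x) o)) o := (prime_middle _ _ _).symm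
    _ = i (i (i x o) (i y x)) o := by rw [h x (i y x)]
    _ = i (i o y) x := by rw [rotate_prime, o_o_imp]
  have self_imp_prime (x) : i (i x x) o = i o x := calc
    i (i x x) o = i (i x (i x o)) o := (prime_middle _ _ _).symm
    _ = i (i x (i (i o x) o)) o := by rw [prime_o_imp]
    _ = i (i (i x o) (i o (i x o))) o := by rw [← h x (i o x), o_prime]
    _ = i o x := by rw [imp_imp_self_prime, oo, o_prime]
  -- 0 → x = x → 0
  have o_imp (x) : i o x = i x o := calc
    i o x = i (i o (i x x)) o := by rw [prime_o_imp, self_imp_prime]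
    _ = i (i o (i (i x x) o)) o := by rw [o_prime]
    _ = i x o := by rw [self_imp_prime, o_o_imp, prime_o_imp]
  have o_imp_imp_prime (x y) : i o (i x (i y o)) = i o (i x y) := by
    rw [o_imp, prime_middle, o_imp]
  have o_imp_imp_o_imp (x y) : i o (i x (i o (i y x))) = i y (i x o) := calc
    i o (i x (i o (i y x))) = i (i x (i (i y (i x o)) o)) o := by
      rw [o_imp, ← o_imp_imp_prime y x, o_imp (i y (i x o))]
    _ = i (i o y) (i x o) := by rw [← h x (i y (i x o)), imp_imp_self_prime]
    _ = i y (i x o) := by rw [← h (i o y), prime_o_imp, h]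
  -- x → (y → 0) = (x → y) → 0
  have imp_prime (x y) : i x (i y o) = i (i x y) o := by
    rw [← o_imp_imp_o_imp y x, ← o_o_imp, o_imp_imp_o_imp, o_imp_imp_prime, o_imp]
  have imp_imp_prime (x y z) : i (i (i x y) z) o = i (i x y) z := calc
    i (i (i x y) z) o = i (i (i x y) o) z := by rw [h, imp_prime]
    _ = i (i x y) z := by rw [← imp_prime, prime_middle]
  have rotate (x y z) : i (i x y) (i z x) = i (i y z) x := by
    rw [← imp_imp_prime x y, rotate_prime, o_imp, prime_middle]
  have imp_imp_left (x y) : i (i x y) x = i y (i x o) := calc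
    i (i x y) x = i (i (i x y) (i o x)) o := by rw [o_imp, prime_middle, imp_imp_prime]
    _ = i y (i x o) := by rw [rotate_prime, oo, h]
  intro x y
  calc
    i (i x y) (i y o) = i (i (i y o) x) (i y (i y o)) := (rotate _ _ _).symm
    _ = i (i (i y o) x) (i y o) := by rw [imp_prime y y, self_imp_prime, o_imp]
    _ = i x (i y o) := by rw [imp_imp_left, prime_prime]
end

section
/- Let A be an implication zroupoid satisfying x'' ≈ x and the identity (x → y)' ≈ x → (0 → y) (for all x, y in A). Then A satisfies the identity x → y' ≈ x → (0 → y) (for all x, y in A). -/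
/-- In any implication zroupoid satisfying x'' ≈ x and
    (x → y)' ≈ x → (0 → y), the identity x → y' ≈ x → (0 → y) holds. -/
theorem stmt_1 {A : Type*} (i : A → A → A) (o : A)
    (hI : ∀ x y z : A, i (i x y) z = i (i (i (i z o) x) (i (i y z) o)) o)
    (h0 : i (i o o) o = o)
    (hinv : ∀ x : A, i (i x o) o = x)
    (h : ∀ x y : A, i (i x y) o = i x (i o y)) :
    ∀ x y : A, i x (i y o) = i x (i o y) := by
  have left_one (x : A) : i (i o o) x = x := by
    have e := hI x o o
    rw [h0, hinv, hinv] at e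
    exact e.symm
  have zero_left (y : A) : i y o = i o y := by
    simpa only [left_one] using h (i o o) y
  intro x y
  rw [zero_left]
end

section
/- Let A be an implication zroupoid satisfying x'' ≈ x and the identity (x → y)' ≈ x → (0 → y) (for all x, y in A). Then A satisfies the identity (x → (y → z)')' ≈ x → (y → (0 → z))' (for all x, y, z in A). -/
/-- In any implication zroupoid satisfying x'' ≈ x and
    (x → y)' ≈ x → (0 → y), the identity
    (x → (y → z)')' ≈ x → (y → (0 → z))' holds. -/
theorem stmt_2 {A : Type*} (i : A → A → A) (o : A)
    (hI : ∀ x y z : A, i (i x y) z = i (i (i (i z o) x) (i (i y z) o)) o)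
    (h0 : i (i o o) o = o)
    (hinv : ∀ x : A, i (i x o) o = x)
    (h : ∀ x y : A, i (i x y) o = i x (i o y)) :
    ∀ x y z : A, i (i x (i (i y z) o)) o = i x (i (i y (i o z)) o) := by
  have one_imp (x : A) : i (i o o) x = x := by
    have e := hI x o o
    rw [h0, hinv, hinv] at e
    exact e.symm
  have zero_imp (x : A) : i o x = i x o := by
    have e := h (i o o) x
    rw [one_imp, one_imp] at e
    exact e.symm
  intro x y z
  rw [h x, zero_imp, hinv, ← h y, hinv]
end

section
/- Let A be an implication zroupoid satisfying the identities (x → y)' ≈ x → (0 → y) and x' → y ≈ x → y' (for all x, y in A). Then A satisfies the identity 0 → (x → (y → z)) ≈ 0 → ((x → y) → z) (for all x, y, z in A). -/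
/-- In any implication zroupoid satisfying
    (x → y)' ≈ x → (0 → y) and x' → y ≈ x → y', the identity
    0 → (x → (y → z)) ≈ 0 → ((x → y) → z) holds. -/
theorem stmt_3 {A : Type*} (i : A → A → A) (o : A)
    (hI : ∀ x y z : A, i (i x y) z = i (i (i (i z o) x) (i (i y z) o)) o)
    (h0 : i (i o o) o = o)
    (h1 : ∀ x y : A, i (i x y) o = i x (i o y))
    (h2 : ∀ x y : A, i (i x o) y = i x (i y o)) :
    ∀ x y z : A, i o (i x (i y z)) = i o (i (i x y) z) := by
  intro x y z
  grind (ematch := 20) (gen := 20) (instances := 20000)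
end

section
/- Let A be an implication zroupoid satisfying the identity (x → y)' ≈ (y → x)' (for all x, y in A). Then A satisfies the identity (x → y) → z ≈ (y → x) → z (for all x, y, z in A). -/
/-- An implication zroupoid in which the complements `(x ⇒ y) ⇒ 0` and `(y ⇒ x) ⇒ 0` agree. -/
class SymmImplicationZroupoid (A : Type*) where
  imp : A → A → A
  zero : A
  imp_imp (x y z : A) :
    imp (imp x y) z = imp (imp (imp (imp z zero) x) (imp (imp y z) zero)) zero
  zero_compl_compl : imp (imp zero zero) zero = zero
  compl_imp_comm (x y : A) : imp (imp x y) zero = imp (imp y x) zero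

namespace SymmImplicationZroupoid

local notation:60 x:61 "⇒" y:60 => imp x y
local notation "𝟬" => zero
local notation:max x:max "°" => imp x zero

variable {A : Type*} [SymmImplicationZroupoid A]

theorem compl_zero_imp_compl_zero : ((𝟬 : A) ⇒ 𝟬°)° = 𝟬° := by
  rw [← compl_imp_comm 𝟬° 𝟬, zero_compl_compl]

theorem compl_zero_imp_eq_compl_compl (x : A) : (𝟬 ⇒ x)° = (𝟬 ⇒ x°°)° := by
  rw [imp_imp 𝟬 x 𝟬, zero_compl_compl]

theorem compl_compl_eq_zero_imp_imp (x : A) : x°° = (𝟬 ⇒ 𝟬° ⇒ x)° := by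
  rw [imp_imp x 𝟬 𝟬, zero_compl_compl, compl_imp_comm (𝟬° ⇒ x) 𝟬]

theorem compl_zero_imp_imp_comm (x y : A) : (𝟬 ⇒ x ⇒ y)° = (𝟬 ⇒ y ⇒ x)° := by
  rw [← compl_imp_comm (x ⇒ y) 𝟬, compl_imp_comm x y, compl_imp_comm (y ⇒ x) 𝟬]

theorem imp_imp_compl_eq (x y z w : A) :
    (x ⇒ y° ⇒ z) ⇒ (w ⇒ y)° = (((𝟬 ⇒ w ⇒ y)° ⇒ x) ⇒ (z ⇒ w) ⇒ y)° := by
  rw [imp_imp x (y° ⇒ z) (w ⇒ y)°, ← imp_imp z w y, compl_imp_comm (w ⇒ y) 𝟬]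

theorem compl_zero_imp_eq_zero_imp (x : A) : (𝟬 ⇒ x)° = (𝟬 ⇒ 𝟬 ⇒ x°)° := by
  rw [compl_zero_imp_eq_compl_compl x, compl_zero_imp_imp_comm x° 𝟬]

theorem compl_zero_imp_eq_zero_imp_zero_imp (x : A) : (𝟬 ⇒ x)° = (𝟬 ⇒ 𝟬 ⇒ 𝟬 ⇒ x)° := by
  rw [compl_zero_imp_eq_compl_compl x, compl_imp_comm x 𝟬, compl_zero_imp_imp_comm (𝟬 ⇒ x) 𝟬]

theorem compl_imp_imp_compl_eq (x y z w : A) :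
    (x ⇒ (y° ⇒ z) ⇒ (w ⇒ y)°)° = ((𝟬° ⇒ x) ⇒ ((z ⇒ w) ⇒ y)°)° := by
  rw [imp_imp x ((y° ⇒ z) ⇒ (w ⇒ y)°) 𝟬, ← imp_imp z w y]

theorem compl_zero_imp_imp_compl_zero (x : A) : (𝟬 ⇒ x ⇒ 𝟬°)° = x°° := by
  rw [← compl_zero_imp_imp_comm 𝟬° x, ← compl_compl_eq_zero_imp_imp x]

theorem compl_compl_eq_compl_zero_imp (x : A) : x°° = (𝟬 ⇒ x)° := by
  rw [← compl_zero_imp_imp_compl_zero x, compl_zero_imp_eq_zero_imp_zero_imp (x ⇒ 𝟬°),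
    ← compl_zero_imp_imp_comm (𝟬 ⇒ x ⇒ 𝟬°) 𝟬, compl_zero_imp_imp_compl_zero x,
    compl_zero_imp_imp_comm x° 𝟬, ← compl_zero_imp_eq_zero_imp x]

theorem compl_imp_compl_zero_imp (x y : A) : (x ⇒ 𝟬° ⇒ y)° = (x ⇒ y)° :=
  calc (x ⇒ 𝟬° ⇒ y)°
    _ = (x ⇒ 𝟬° ⇒ y) ⇒ 𝟬°° := congrArg (fun t ↦ (x ⇒ 𝟬° ⇒ y) ⇒ t) zero_compl_compl.symm
    _ = (((𝟬 ⇒ 𝟬°)° ⇒ x) ⇒ y°°)° := imp_imp_compl_eq x 𝟬 y 𝟬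
    _ = ((𝟬° ⇒ x) ⇒ y°°)° := by rw [compl_zero_imp_compl_zero]
    _ = (x ⇒ y)° := (imp_imp x y 𝟬).symm

theorem compl_imp_zero_imp_compl_zero (x : A) : (x ⇒ 𝟬 ⇒ 𝟬°)° = x°° :=
  calc (x ⇒ 𝟬 ⇒ 𝟬°)°
    _ = (x ⇒ 𝟬 ⇒ 𝟬°°°)° := congrArg (fun t ↦ (x ⇒ 𝟬 ⇒ t°)°) zero_compl_compl.symm
    _ = (x ⇒ 𝟬°° ⇒ 𝟬°°°)° := congrArg (fun t ↦ (x ⇒ t ⇒ 𝟬°°°)°) zero_compl_compl.symm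
    _ = ((𝟬° ⇒ x) ⇒ (𝟬 ⇒ 𝟬°)°°)° := compl_imp_imp_compl_eq x 𝟬 𝟬 𝟬°
    _ = ((𝟬° ⇒ x) ⇒ 𝟬°°)° := by rw [compl_zero_imp_compl_zero]
    _ = (𝟬° ⇒ x)°° := by rw [zero_compl_compl]
    _ = (𝟬 ⇒ 𝟬° ⇒ x)° := compl_imp_comm (𝟬° ⇒ x) 𝟬
    _ = x°° := (compl_compl_eq_zero_imp_imp x).symm

theorem compl_imp_eq_compl_zero_imp_imp (x y : A) : (x ⇒ y)° = ((𝟬° ⇒ y) ⇒ x)° := by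
  rw [← compl_imp_compl_zero_imp x y, compl_imp_comm x (𝟬° ⇒ y)]

theorem compl_compl_imp_imp (x y z : A) : ((x ⇒ y)° ⇒ y° ⇒ z)° = (z ⇒ x) ⇒ y := by
  rw [← compl_imp_comm (y° ⇒ z) (x ⇒ y)°, ← imp_imp z x y]

theorem imp_imp_zero_imp_compl_zero (x y : A) : (x ⇒ y) ⇒ 𝟬 ⇒ 𝟬° = (x ⇒ y)° := by
  rw [imp_imp x y (𝟬 ⇒ 𝟬°), compl_imp_zero_imp_compl_zero y, compl_zero_imp_compl_zero,
    ← imp_imp x y 𝟬]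

theorem compl_compl_compl_imp (x y : A) : (x°° ⇒ y)° = (y ⇒ x)° := by
  rw [compl_imp_eq_compl_zero_imp_imp x°° y, ← imp_imp y x 𝟬]

theorem compl_imp_eq_compl_compl_zero_imp (x y : A) : (x ⇒ y)° = ((𝟬 ⇒ y)° ⇒ x)° := by
  rw [← compl_compl_imp_imp y 𝟬 x, compl_compl_eq_compl_zero_imp y,
    compl_imp_compl_zero_imp (𝟬 ⇒ y)° x]

theorem zero_imp_imp_eq (x y : A) : (𝟬 ⇒ x) ⇒ y = (y ⇒ (x ⇒ y)°)° := by
  rw [imp_imp 𝟬 x y, compl_imp_comm y 𝟬, ← compl_imp_eq_compl_compl_zero_imp (x ⇒ y)° y,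
    compl_imp_comm (x ⇒ y)° y]

theorem compl_imp_compl_compl (x y : A) : (x ⇒ y)° = (x ⇒ y°°)° := by
  rw [← compl_compl_compl_imp y x, compl_imp_comm y°° x]

theorem compl_imp_eq_compl (x y : A) : x° ⇒ y = (y ⇒ y° ⇒ x)° := by
  rw [← compl_compl_imp_imp 𝟬 y x, ← compl_compl_eq_compl_zero_imp y,
    compl_compl_compl_imp y (y° ⇒ x), compl_imp_comm (y° ⇒ x) y]

theorem compl_zero_imp_self (x : A) : 𝟬° ⇒ x = (x ⇒ x)° := by
  rw [← compl_zero_imp_compl_zero, compl_imp_eq_compl (𝟬 ⇒ 𝟬°) x, imp_imp_zero_imp_compl_zero x 𝟬,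
    ← compl_imp_compl_compl x x]

theorem imp_imp_self_right (x y : A) : (x ⇒ y) ⇒ y = x° ⇒ y := by
  rw [imp_imp x y y, ← compl_zero_imp_self y, compl_imp_compl_zero_imp (y° ⇒ x) y,
    compl_imp_comm (y° ⇒ x) y, ← compl_imp_eq_compl x y]

theorem compl_zero_eq_imp_self : (𝟬 : A)° = 𝟬° ⇒ 𝟬° :=
  calc 𝟬°
    _ = (𝟬 ⇒ 𝟬°)° := compl_zero_imp_compl_zero.symm
    _ = (𝟬° ⇒ 𝟬°)°° := compl_imp_eq_compl_zero_imp_imp 𝟬 𝟬°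
    _ = (𝟬° ⇒ 𝟬°)° := congrArg (fun t ↦ t°) (compl_zero_imp_self 𝟬°).symm
    _ = 𝟬° ⇒ 𝟬° := (compl_zero_imp_self 𝟬°).symm

theorem compl_zero : (𝟬 : A)° = 𝟬 := by
  rw [compl_zero_eq_imp_self, compl_zero_imp_self 𝟬°, ← compl_zero_eq_imp_self, zero_compl_compl]

theorem zero_imp_eq_compl_imp_self (x : A) : 𝟬 ⇒ x = (x ⇒ x)° :=
  calc 𝟬 ⇒ x
    _ = 𝟬° ⇒ x := congrArg (fun t ↦ t ⇒ x) compl_zero.symm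
    _ = (x ⇒ x)° := compl_zero_imp_self x

theorem zero_imp_imp_self (x : A) : (𝟬 ⇒ x) ⇒ x = 𝟬 ⇒ x := by
  rw [imp_imp_self_right 𝟬 x, compl_zero]

theorem compl_imp_eq_compl_zero_imp (x y : A) : (x ⇒ y)° = ((𝟬 ⇒ x) ⇒ y)° :=
  calc (x ⇒ y)°
    _ = (x ⇒ y) ⇒ 𝟬° := congrArg (fun t ↦ (x ⇒ y) ⇒ t) compl_zero.symm
    _ = (x ⇒ y) ⇒ 𝟬 ⇒ 𝟬° := congrArg (fun t ↦ (x ⇒ y) ⇒ 𝟬 ⇒ t) compl_zero.symm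
    _ = (((𝟬 ⇒ 𝟬°)° ⇒ x) ⇒ (y ⇒ 𝟬 ⇒ 𝟬°)°)° := imp_imp x y (𝟬 ⇒ 𝟬°)
    _ = ((𝟬° ⇒ x) ⇒ (y ⇒ 𝟬 ⇒ 𝟬°)°)° := by rw [compl_zero_imp_compl_zero]
    _ = ((𝟬 ⇒ x) ⇒ (y ⇒ 𝟬 ⇒ 𝟬°)°)° := by rw [compl_zero]
    _ = ((𝟬 ⇒ x) ⇒ (y ⇒ 𝟬°)°)° := congrArg (fun t ↦ ((𝟬 ⇒ x) ⇒ (y ⇒ 𝟬 ⇒ t)°)°) compl_zero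
    _ = ((𝟬 ⇒ x) ⇒ y°°)° := by rw [compl_zero]
    _ = ((𝟬 ⇒ x) ⇒ y)° := (compl_imp_compl_compl (𝟬 ⇒ x) y).symm

theorem zero_imp_eq_compl_zero_imp (x : A) : 𝟬 ⇒ x = (𝟬 ⇒ x)° :=
  calc 𝟬 ⇒ x
    _ = (x ⇒ x)° := zero_imp_eq_compl_imp_self x
    _ = ((𝟬 ⇒ x) ⇒ x)° := compl_imp_eq_compl_zero_imp x x
    _ = (𝟬° ⇒ x)° := by rw [imp_imp_self_right 𝟬 x]
    _ = (𝟬 ⇒ x)° := by rw [compl_zero]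

theorem compl_compl_eq_zero_imp (x : A) : x°° = 𝟬 ⇒ x := by
  rw [compl_compl_eq_compl_zero_imp x, ← zero_imp_eq_compl_zero_imp x]

theorem zero_imp_compl (x : A) : 𝟬 ⇒ x = 𝟬 ⇒ x° := by
  rw [zero_imp_eq_compl_zero_imp x, ← compl_compl_imp_imp x 𝟬 𝟬, ← zero_imp_eq_compl_zero_imp 𝟬,
    compl_zero, compl_imp_comm x° 𝟬, ← zero_imp_eq_compl_zero_imp x°,
    ← zero_imp_eq_compl_zero_imp x°]

theorem zero_imp_imp_comm (x y : A) : 𝟬 ⇒ x ⇒ y = 𝟬 ⇒ y ⇒ x := by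
  rw [zero_imp_eq_compl_zero_imp (x ⇒ y), compl_zero_imp_imp_comm x y,
    ← zero_imp_eq_compl_zero_imp (y ⇒ x)]

theorem compl_imp_zero_imp (x y : A) : (x ⇒ 𝟬 ⇒ y)° = (x ⇒ y)° :=
  calc (x ⇒ 𝟬 ⇒ y)°
    _ = (x ⇒ 𝟬° ⇒ y)° := congrArg (fun t ↦ (x ⇒ t ⇒ y)°) compl_zero.symm
    _ = (x ⇒ y)° := compl_imp_compl_zero_imp x y

theorem imp_self_imp_imp_self (x y : A) : ((x ⇒ x) ⇒ y) ⇒ y = (𝟬 ⇒ x) ⇒ y := by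
  rw [imp_imp_self_right (x ⇒ x) y, ← zero_imp_eq_compl_imp_self x]

theorem zero_imp_eq_compl_imp_imp_self (x : A) : 𝟬 ⇒ x = (x° ⇒ x) ⇒ x := by
  rw [← zero_imp_imp_self x, ← imp_self_imp_imp_self x x, imp_imp_self_right x x]

theorem compl_imp_self (x : A) : x° ⇒ x = 𝟬 ⇒ x := by
  rw [compl_imp_eq_compl x x, ← compl_imp_comm (x° ⇒ x) x, ← zero_imp_eq_compl_imp_imp_self x,
    ← zero_imp_eq_compl_zero_imp x]

theorem imp_imp_self_left (x y : A) : (x ⇒ y) ⇒ x = (𝟬 ⇒ y) ⇒ x := by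
  rw [imp_imp x y x, compl_imp_self x, ← compl_imp_eq_compl_zero_imp x (y ⇒ x)°,
    ← zero_imp_imp_eq y x]

theorem imp_zero_imp_imp (x y z : A) : (x ⇒ 𝟬 ⇒ y) ⇒ z = (x ⇒ y) ⇒ z := by
  rw [imp_imp x (𝟬 ⇒ y) z, ← compl_imp_eq_compl_zero_imp y z, ← imp_imp x y z]

theorem zero_imp_imp_imp_self (x y : A) : ((𝟬 ⇒ x) ⇒ y) ⇒ y = (𝟬 ⇒ x) ⇒ y := by
  rw [imp_imp_self_right (𝟬 ⇒ x) y, ← zero_imp_eq_compl_zero_imp x]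

theorem zero_imp_zero_imp_imp (x y : A) : 𝟬 ⇒ (𝟬 ⇒ x) ⇒ y = 𝟬 ⇒ x ⇒ y := by
  rw [← compl_compl_eq_zero_imp ((𝟬 ⇒ x) ⇒ y), ← compl_imp_eq_compl_zero_imp x y,
    compl_imp_comm (x ⇒ y) 𝟬, ← zero_imp_eq_compl_zero_imp (x ⇒ y)]

theorem compl_compl_imp (x y : A) : (x° ⇒ y)° = (x ⇒ y)° := by
  rw [compl_imp_eq_compl_zero_imp x° y, ← zero_imp_compl x, ← compl_imp_eq_compl_zero_imp x y]

theorem compl_imp_compl (x y : A) : (x ⇒ y°)° = (x ⇒ y)° := by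
  rw [← compl_imp_zero_imp x y°, ← zero_imp_compl y, compl_imp_zero_imp x y]

theorem compl_imp_eq_compl_imp (x y : A) : x° ⇒ y = (x ⇒ y)° := by
  rw [compl_imp_eq_compl x y, ← compl_imp_comm (y° ⇒ x) y, ← compl_imp_compl (y° ⇒ x) y,
    imp_imp_self_left y° x, ← compl_imp_eq_compl_zero_imp x y°, compl_imp_compl x y]

theorem zero_imp_imp_eq_compl (x y : A) : 𝟬 ⇒ x ⇒ y = (x ⇒ y)° :=
  calc 𝟬 ⇒ x ⇒ y
    _ = (𝟬 ⇒ x ⇒ y)° := zero_imp_eq_compl_zero_imp (x ⇒ y)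
    _ = (x ⇒ y)°° := (compl_imp_comm (x ⇒ y) 𝟬).symm
    _ = (x° ⇒ y)° := by rw [← compl_imp_eq_compl_imp x y]
    _ = (x ⇒ y)° := compl_compl_imp x y

theorem compl_imp_eq_zero_imp (x y : A) : x° ⇒ y = 𝟬 ⇒ x ⇒ y := by
  rw [compl_imp_eq_compl_imp x y, ← zero_imp_imp_eq_compl x y]

theorem imp_imp_self_eq_zero_imp (x y : A) : (x ⇒ y) ⇒ y = 𝟬 ⇒ x ⇒ y := by
  rw [imp_imp_self_right x y, compl_imp_eq_zero_imp x y]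

theorem zero_imp_imp (x y : A) : 𝟬 ⇒ x ⇒ y = (𝟬 ⇒ x) ⇒ y := by
  rw [← zero_imp_zero_imp_imp x y, ← imp_imp_self_eq_zero_imp (𝟬 ⇒ x) y, zero_imp_imp_imp_self x y]

theorem zero_imp_imp_imp (x y z : A) : 𝟬 ⇒ (x ⇒ y) ⇒ z = (x ⇒ y) ⇒ z := by
  rw [zero_imp_imp (x ⇒ y) z, zero_imp_imp x y, imp_imp (𝟬 ⇒ x) y z,
    imp_zero_imp_imp z° x (y ⇒ z)°, ← imp_imp x y z]

theorem imp_imp_comm_left (x y z : A) : (x ⇒ y) ⇒ z = (y ⇒ x) ⇒ z := by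
  rw [← zero_imp_imp_imp x y z, zero_imp_imp (x ⇒ y) z, ← zero_imp_imp_imp 𝟬 (x ⇒ y) z,
    zero_imp_imp_comm x y, ← zero_imp_imp (y ⇒ x) z, zero_imp_imp_imp y x z,
    zero_imp_imp_imp y x z]

end SymmImplicationZroupoid

/-- In any implication zroupoid satisfying (x → y)' ≈ (y → x)',
    the identity (x → y) → z ≈ (y → x) → z holds. -/
theorem stmt_4 {A : Type*} (i : A → A → A) (o : A)
    (hI : ∀ x y z : A, i (i x y) z = i (i (i (i z o) x) (i (i y z) o)) o)
    (h0 : i (i o o) o = o)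
    (h : ∀ x y : A, i (i x y) o = i (i y x) o) :
    ∀ x y z : A, i (i x y) z = i (i y x) z := by
  let _ : SymmImplicationZroupoid A := ⟨i, o, hI, h0, h⟩
  exact SymmImplicationZroupoid.imp_imp_comm_left (A := A)
end

section
/- Let A be an implication zroupoid of type 1, i.e., A satisfies: (E1) (x → y)' ≈ x → (0 → y); (E2) x' → y ≈ x → y'; (E3) 0 → (x → y) ≈ 0 → (y → x); and (E4) there exists a permutation (p(x), p(y), p(z)) of the triple (x, y, z) such that x → (y → z) ≈ (p(x) → p(y)) → p(z) holds for all x, y, z in A. Then A satisfies every one of the fourteen identities (A1)–(A14) of associative type of length 3. -/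
theorem assoc_of_xzy {A : Type*} (i : A → A → A) (o : A)
    (hI : ∀ x y z : A, i (i x y) z = i (i (i (i z o) x) (i (i y z) o)) o)
    (h0 : i (i o o) o = o)
    (hE1 : ∀ x y : A, i (i x y) o = i x (i o y))
    (hE2 : ∀ x y : A, i (i x o) y = i x (i y o))
    (hE3 : ∀ x y : A, i o (i x y) = i o (i y x))
    (h : ∀ x y z : A, i x (i y z) = i (i x z) y) :
    ∀ x y z : A, i x (i y z) = i (i x y) z := by
  intro x y z
  grind

theorem assoc_of_yxz {A : Type*} (i : A → A → A) (o : A)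
    (hI : ∀ x y z : A, i (i x y) z = i (i (i (i z o) x) (i (i y z) o)) o)
    (h0 : i (i o o) o = o)
    (hE1 : ∀ x y : A, i (i x y) o = i x (i o y))
    (hE2 : ∀ x y : A, i (i x o) y = i x (i y o))
    (hE3 : ∀ x y : A, i o (i x y) = i o (i y x))
    (h : ∀ x y z : A, i x (i y z) = i (i y x) z) :
    ∀ x y z : A, i x (i y z) = i (i x y) z := by
  intro x y z
  grind

theorem assoc_of_yzx {A : Type*} (i : A → A → A) (o : A)
    (hI : ∀ x y z : A, i (i x y) z = i (i (i (i z o) x) (i (i y z) o)) o)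
    (h0 : i (i o o) o = o)
    (hE1 : ∀ x y : A, i (i x y) o = i x (i o y))
    (hE2 : ∀ x y : A, i (i x o) y = i x (i y o))
    (hE3 : ∀ x y : A, i o (i x y) = i o (i y x))
    (h : ∀ x y z : A, i x (i y z) = i (i y z) x) :
    ∀ x y z : A, i x (i y z) = i (i x y) z := by
  intro x y z
  grind

theorem assoc_of_zxy {A : Type*} (i : A → A → A) (o : A)
    (hI : ∀ x y z : A, i (i x y) z = i (i (i (i z o) x) (i (i y z) o)) o)
    (h0 : i (i o o) o = o)
    (hE1 : ∀ x y : A, i (i x y) o = i x (i o y))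
    (hE2 : ∀ x y : A, i (i x o) y = i x (i y o))
    (hE3 : ∀ x y : A, i o (i x y) = i o (i y x))
    (h : ∀ x y z : A, i x (i y z) = i (i z x) y) :
    ∀ x y z : A, i x (i y z) = i (i x y) z := by
  intro x y z
  grind

theorem assoc_of_zyx {A : Type*} (i : A → A → A) (o : A)
    (hI : ∀ x y z : A, i (i x y) z = i (i (i (i z o) x) (i (i y z) o)) o)
    (h0 : i (i o o) o = o)
    (hE1 : ∀ x y : A, i (i x y) o = i x (i o y))
    (hE2 : ∀ x y : A, i (i x o) y = i x (i y o))
    (hE3 : ∀ x y : A, i o (i x y) = i o (i y x))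
    (h : ∀ x y z : A, i x (i y z) = i (i z y) x) :
    ∀ x y z : A, i x (i y z) = i (i x y) z := by
  intro x y z
  grind

theorem left_comm_of_assoc {A : Type*} (i : A → A → A) (o : A)
    (hI : ∀ x y z : A, i (i x y) z = i (i (i (i z o) x) (i (i y z) o)) o)
    (h0 : i (i o o) o = o)
    (hE1 : ∀ x y : A, i (i x y) o = i x (i o y))
    (hE2 : ∀ x y : A, i (i x o) y = i x (i y o))
    (hE3 : ∀ x y : A, i o (i x y) = i o (i y x))
    (h : ∀ x y z : A, i x (i y z) = i (i x y) z) :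
    ∀ x y z : A, i (i x y) z = i (i y x) z := by
  intro x y z
  grind

theorem right_comm_of_assoc {A : Type*} (i : A → A → A) (o : A)
    (hI : ∀ x y z : A, i (i x y) z = i (i (i (i z o) x) (i (i y z) o)) o)
    (h0 : i (i o o) o = o)
    (hE1 : ∀ x y : A, i (i x y) o = i x (i o y))
    (hE2 : ∀ x y : A, i (i x o) y = i x (i y o))
    (hE3 : ∀ x y : A, i o (i x y) = i o (i y x))
    (h : ∀ x y z : A, i x (i y z) = i (i x y) z) :
    ∀ x y z : A, i (i x y) z = i (i x z) y := by
  intro x y z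
  grind

/-- Any implication zroupoid of type 1 (satisfying E1-E4)
    satisfies all fourteen identities (A1)-(A14) of associative type of length 3. -/
theorem stmt_5 {A : Type*} (i : A → A → A) (o : A)
    (hI : ∀ x y z : A, i (i x y) z = i (i (i (i z o) x) (i (i y z) o)) o)
    (h0 : i (i o o) o = o)
    (hE1 : ∀ x y : A, i (i x y) o = i x (i o y))
    (hE2 : ∀ x y : A, i (i x o) y = i x (i y o))
    (hE3 : ∀ x y : A, i o (i x y) = i o (i y x))
    (hE4 : ∃ p : Equiv.Perm (Fin 3), ∀ x y z : A,
      i x (i y z) = i (i (![x, y, z] (p 0)) (![x, y, z] (p 1))) (![x, y, z] (p 2))) :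
    (∀ x y z : A, i x (i y z) = i (i x y) z) ∧   -- (A1)
    (∀ x y z : A, i x (i y z) = i x (i z y)) ∧   -- (A2)
    (∀ x y z : A, i x (i y z) = i (i x z) y) ∧   -- (A3)
    (∀ x y z : A, i x (i y z) = i y (i x z)) ∧   -- (A4)
    (∀ x y z : A, i x (i y z) = i (i y x) z) ∧   -- (A5)
    (∀ x y z : A, i x (i y z) = i y (i z x)) ∧   -- (A6)
    (∀ x y z : A, i x (i y z) = i (i y z) x) ∧   -- (A7)
    (∀ x y z : A, i x (i y z) = i (i z x) y) ∧   -- (A8)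
    (∀ x y z : A, i x (i y z) = i z (i y x)) ∧   -- (A9)
    (∀ x y z : A, i x (i y z) = i (i z y) x) ∧   -- (A10)
    (∀ x y z : A, i (i x y) z = i (i x z) y) ∧   -- (A11)
    (∀ x y z : A, i (i x y) z = i (i y x) z) ∧   -- (A12)
    (∀ x y z : A, i (i x y) z = i (i y z) x) ∧   -- (A13)
    (∀ x y z : A, i (i x y) z = i (i z y) x) := by -- (A14)
  have assoc : ∀ x y z : A, i x (i y z) = i (i x y) z := by
    obtain ⟨p, hp⟩ := hE4
    have h01 : p 0 ≠ p 1 := p.injective.ne (by decide)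
    have h02 : p 0 ≠ p 2 := p.injective.ne (by decide)
    have h12 : p 1 ≠ p 2 := p.injective.ne (by decide)
    generalize p 0 = a at *
    generalize p 1 = b at *
    generalize p 2 = c at *
    fin_cases a <;> fin_cases b <;> fin_cases c <;> first
      | exact absurd rfl h01
      | exact absurd rfl h02
      | exact absurd rfl h12
      | exact hp
      | exact assoc_of_xzy i o hI h0 hE1 hE2 hE3 hp
      | exact assoc_of_yxz i o hI h0 hE1 hE2 hE3 hp
      | exact assoc_of_yzx i o hI h0 hE1 hE2 hE3 hp
      | exact assoc_of_zxy i o hI h0 hE1 hE2 hE3 hp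
      | exact assoc_of_zyx i o hI h0 hE1 hE2 hE3 hp
  have swap_left := left_comm_of_assoc i o hI h0 hE1 hE2 hE3 assoc
  have swap_right := right_comm_of_assoc i o hI h0 hE1 hE2 hE3 assoc
  refine ⟨?_, ?_, ?_, ?_, ?_, ?_, ?_, ?_, ?_, ?_, ?_, ?_, ?_, ?_⟩ <;> intro x y z <;> grind
end

section
/- Let A be an implication zroupoid satisfying the identity (A5): x → (y → z) ≈ (y → x) → z (for all x, y, z in A). Then A satisfies the identities: (a) x' → y ≈ x → y'; (b) (x → y)' ≈ 0 → (x → y); (c) x → (0 → y) ≈ 0 → (x → y) (for all x, y in A). -/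
/-- In any implication zroupoid satisfying (A5): x → (y → z) ≈ (y → x) → z,
    the identities (a) x' → y ≈ x → y', (b) (x → y)' ≈ 0 → (x → y),
    (c) x → (0 → y) ≈ 0 → (x → y) hold. -/
theorem stmt_6 {A : Type*} (i : A → A → A) (o : A)
    (hI : ∀ x y z : A, i (i x y) z = i (i (i (i z o) x) (i (i y z) o)) o)
    (h0 : i (i o o) o = o)
    (hA5 : ∀ x y z : A, i x (i y z) = i (i y x) z) :
    (∀ x y : A, i (i x o) y = i x (i y o)) ∧
    (∀ x y : A, i (i x y) o = i o (i x y)) ∧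
    (∀ x y : A, i x (i o y) = i o (i x y)) := by
  have mul (x y z : A) : i (i x y) z = i y (i x z) := (hA5 y x z).symm
  have left_comm_zero (y z w : A) : i o (i z (i y w)) = i o (i y (i z w)) := by
    have h : i (i (i y z) o) w = i (i z (i y o)) w := by rw [mul y z o]
    rwa [mul (i y z) o, mul y z, mul z, mul y o] at h
  have expand (x y z : A) : i y (i x z) = i o (i y (i z (i x (i o (i z o))))) := by
    have h := hI x y z
    rwa [mul x y z, mul (i (i z o) x), mul (i y z) o, mul y z, mul (i z o) x, mul z o,
      left_comm_zero y z] at h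
  have zero_zero : i o (i o o) = o := by rw [← mul, h0]
  have pair (x y : A) : i y (i x o) = i o (i y (i o (i x o))) := by
    have h := expand x y o
    rwa [zero_zero] at h
  have right_zero (y : A) : i y (i o o) = i o (i y o) := by
    rw [pair, zero_zero]
  have move_zero (x y : A) : i y (i o (i x o)) = i o (i y (i x o)) := by
    have h := right_zero (i x y)
    rwa [mul, mul, right_zero] at h
  have zero_twice (x : A) : i o (i o (i x o)) = i x o := by
    rw [← right_zero, ← mul o x, ← right_zero, mul, zero_zero]
  have move_zero' (x y z : A) :
      i z (i o (i y (i x o))) = i o (i z (i y (i x o))) := by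
    simpa only [mul] using move_zero (i x y) z
  have zero_twice' (x y : A) : i o (i o (i y (i x o))) = i y (i x o) := by
    simpa only [mul] using zero_twice (i x y)
  have reduce (x y z : A) : i y (i x z) = i y (i z (i x (i z o))) := by
    have h := expand x y z
    have hcancel := zero_twice' (i (i z x) z) y
    rw [mul (i z x) z o, mul z x o] at hcancel
    have hmove := move_zero' (i z x) z y
    rw [mul z x o] at hmove
    rw [h, move_zero z x, move_zero' z x z, hmove, hcancel]
  have comm (x y : A) : i x (i y o) = i y (i x o) := by
    rw [← zero_twice' y x, left_comm_zero y x, zero_twice']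
  have absorb (x u : A) : i u (i x (i u o)) = i x (i u o) := by
    have h := reduce x o (i u o)
    have h' := zero_twice' (i u x) u
    rw [mul u x o] at h'
    rw [mul u o o, mul u o, move_zero, move_zero', h'] at h
    rw [← h', ← h, zero_twice']
  have idem (u : A) : i u (i u o) = i u o := by
    have h := absorb o u
    rw [move_zero] at h
    rw [← zero_twice', h, zero_twice]
  have zero_prime : i o o = o := by
    rw [← idem o, zero_zero]
  have zero_mul_prime (x : A) : i o (i x o) = i x o := by
    rw [← right_zero, zero_prime]
  have zero_mul (x y : A) : i o (i x y) = i x (i y o) := by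
    rw [reduce, absorb, comm, ← mul x y o, zero_mul_prime, mul, comm]
  refine ⟨fun x y => ?_, fun x y => ?_, fun x y => ?_⟩
  · rw [mul, zero_mul]
  · rw [mul, zero_mul, comm]
  · rw [zero_mul x y, reduce o x y, zero_mul_prime, idem]
end

section
/- Let A be an implication zroupoid satisfying the identity (A8): x → (y → z) ≈ (z → x) → y (for all x, y, z in A). Then A satisfies the identities: (a) x → y' ≈ x' → y'; (b) x → y' ≈ 0 → (y' → x) (for all x, y in A). -/
/-- In any implication zroupoid satisfying (A8): x → (y → z) ≈ (z → x) → y,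
    the identities (a) x → y' ≈ x' → y' and (b) x → y' ≈ 0 → (y' → x) hold. -/
theorem stmt_7 {A : Type*} (i : A → A → A) (o : A)
    (hI : ∀ x y z : A, i (i x y) z = i (i (i (i z o) x) (i (i y z) o)) o)
    (h0 : i (i o o) o = o)
    (hA8 : ∀ x y z : A, i x (i y z) = i (i z x) y) :
    (∀ x y : A, i x (i y o) = i (i x o) (i y o)) ∧
    (∀ x y : A, i x (i y o) = i o (i (i y o) x)) := by
  constructor <;> intro x y <;> grind
end

section
/- Let A be an implication zroupoid satisfying the identity (A10): x → (y → z) ≈ (z → y) → x (for all x, y, z in A). Then A satisfies the identities: (a) (0 → (x → y))' ≈ x → y'; (b) (y → x)'' ≈ x → y'; (c) (x → y)' ≈ x → y' (for all x, y in A). -/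
/-- In any implication zroupoid satisfying (A10): x → (y → z) ≈ (z → y) → x,
    the identities (a) (0 → (x → y))' ≈ x → y', (b) (y → x)'' ≈ x → y',
    (c) (x → y)' ≈ x → y' hold. -/
theorem stmt_8 {A : Type*} (i : A → A → A) (o : A)
    (hI : ∀ x y z : A, i (i x y) z = i (i (i (i z o) x) (i (i y z) o)) o)
    (h0 : i (i o o) o = o)
    (hA10 : ∀ x y z : A, i x (i y z) = i (i z y) x) :
    (∀ x y : A, i (i o (i x y)) o = i x (i y o)) ∧
    (∀ x y : A, i (i (i y x) o) o = i x (i y o)) ∧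
    (∀ x y : A, i (i x y) o = i x (i y o)) := by
  have b : ∀ x y : A, i (i (i y x) o) o = i x (i y o) := by
    intro x y
    grind
  have c : ∀ x y : A, i (i x y) o = i x (i y o) := by
    intro x y
    grind
  refine ⟨fun x y => ?_, b, c⟩
  rw [hA10, b]
end

section
/- Let A be an implication zroupoid that satisfies at least one of the identities (A3): x → (y → z) ≈ (x → z) → y, (A5): x → (y → z) ≈ (y → x) → z, (A7): x → (y → z) ≈ (y → z) → x, (A8): x → (y → z) ≈ (z → x) → y, or (A10): x → (y → z) ≈ (z → y) → x (each for all x, y, z in A). Then A satisfies the identities: (1) (x → y)' ≈ x → (0 → y); (2) x' → y ≈ x → y'; (3) 0 → (x → y) ≈ 0 → (y → x) (for all x, y in A). -/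
theorem implication_zroupoid_of_left_assoc_swap_right {A : Type*} (i : A → A → A) (o : A)
    (hI : ∀ x y z : A, i (i x y) z = i (i (i (i z o) x) (i (i y z) o)) o)
    (h0 : i (i o o) o = o) (h : ∀ x y z : A, i x (i y z) = i (i x z) y) :
    (∀ x y : A, i (i x y) o = i x (i o y)) ∧
    (∀ x y : A, i (i x o) y = i x (i y o)) ∧
    (∀ x y : A, i o (i x y) = i o (i y x)) := by
  have h₂ : ∀ x y : A, i (i x o) y = i x (i y o) := by grind
  have h₁ : ∀ x y : A, i (i x y) o = i x (i o y) := by grind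
  have h₃ : ∀ x y : A, i o (i x y) = i o (i y x) := by grind
  exact ⟨h₁, h₂, h₃⟩

theorem implication_zroupoid_of_left_assoc_swap_left {A : Type*} (i : A → A → A) (o : A)
    (hI : ∀ x y z : A, i (i x y) z = i (i (i (i z o) x) (i (i y z) o)) o)
    (h0 : i (i o o) o = o) (h : ∀ x y z : A, i x (i y z) = i (i y x) z) :
    (∀ x y : A, i (i x y) o = i x (i o y)) ∧
    (∀ x y : A, i (i x o) y = i x (i y o)) ∧
    (∀ x y : A, i o (i x y) = i o (i y x)) := by
  have h₂ : ∀ x y : A, i (i x o) y = i x (i y o) := by grind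
  have h₁ : ∀ x y : A, i (i x y) o = i x (i o y) := by grind
  have h₃ : ∀ x y : A, i o (i x y) = i o (i y x) := by grind
  exact ⟨h₁, h₂, h₃⟩

theorem implication_zroupoid_of_tail_comm {A : Type*} (i : A → A → A) (o : A)
    (hI : ∀ x y z : A, i (i x y) z = i (i (i (i z o) x) (i (i y z) o)) o)
    (h0 : i (i o o) o = o) (h : ∀ x y z : A, i x (i y z) = i (i y z) x) :
    (∀ x y : A, i (i x y) o = i x (i o y)) ∧
    (∀ x y : A, i (i x o) y = i x (i y o)) ∧
    (∀ x y : A, i o (i x y) = i o (i y x)) := by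
  have h₂ : ∀ x y : A, i (i x o) y = i x (i y o) := by grind
  have h₁ : ∀ x y : A, i (i x y) o = i x (i o y) := by grind
  have h₃ : ∀ x y : A, i o (i x y) = i o (i y x) := by grind
  exact ⟨h₁, h₂, h₃⟩

theorem implication_zroupoid_of_rotate {A : Type*} (i : A → A → A) (o : A)
    (hI : ∀ x y z : A, i (i x y) z = i (i (i (i z o) x) (i (i y z) o)) o)
    (h0 : i (i o o) o = o) (h : ∀ x y z : A, i x (i y z) = i (i z x) y) :
    (∀ x y : A, i (i x y) o = i x (i o y)) ∧
    (∀ x y : A, i (i x o) y = i x (i y o)) ∧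
    (∀ x y : A, i o (i x y) = i o (i y x)) := by
  have h₂ : ∀ x y : A, i (i x o) y = i x (i y o) := by grind
  have h₁ : ∀ x y : A, i (i x y) o = i x (i o y) := by grind
  have h₃ : ∀ x y : A, i o (i x y) = i o (i y x) := by grind
  exact ⟨h₁, h₂, h₃⟩

theorem implication_zroupoid_of_reverse {A : Type*} (i : A → A → A) (o : A)
    (hI : ∀ x y z : A, i (i x y) z = i (i (i (i z o) x) (i (i y z) o)) o)
    (h0 : i (i o o) o = o) (h : ∀ x y z : A, i x (i y z) = i (i z y) x) :
    (∀ x y : A, i (i x y) o = i x (i o y)) ∧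
    (∀ x y : A, i (i x o) y = i x (i y o)) ∧
    (∀ x y : A, i o (i x y) = i o (i y x)) := by
  have h₂ : ∀ x y : A, i (i x o) y = i x (i y o) := by grind
  have h₁ : ∀ x y : A, i (i x y) o = i x (i o y) := by grind
  have h₃ : ∀ x y : A, i o (i x y) = i o (i y x) := by grind
  exact ⟨h₁, h₂, h₃⟩

/-- Any implication zroupoid satisfying at least one of
    (A3), (A5), (A7), (A8), (A10) satisfies the identities
    (1) (x → y)' ≈ x → (0 → y), (2) x' → y ≈ x → y',
    (3) 0 → (x → y) ≈ 0 → (y → x). -/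
theorem stmt_9 {A : Type*} (i : A → A → A) (o : A)
    (hI : ∀ x y z : A, i (i x y) z = i (i (i (i z o) x) (i (i y z) o)) o)
    (h0 : i (i o o) o = o)
    (h : (∀ x y z : A, i x (i y z) = i (i x z) y) ∨   -- (A3)
         (∀ x y z : A, i x (i y z) = i (i y x) z) ∨   -- (A5)
         (∀ x y z : A, i x (i y z) = i (i y z) x) ∨   -- (A7)
         (∀ x y z : A, i x (i y z) = i (i z x) y) ∨   -- (A8)
         (∀ x y z : A, i x (i y z) = i (i z y) x)) :  -- (A10)
    (∀ x y : A, i (i x y) o = i x (i o y)) ∧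
    (∀ x y : A, i (i x o) y = i x (i y o)) ∧
    (∀ x y : A, i o (i x y) = i o (i y x)) := by
  rcases h with h | h | h | h | h
  · exact implication_zroupoid_of_left_assoc_swap_right i o hI h0 h
  · exact implication_zroupoid_of_left_assoc_swap_left i o hI h0 h
  · exact implication_zroupoid_of_tail_comm i o hI h0 h
  · exact implication_zroupoid_of_rotate i o hI h0 h
  · exact implication_zroupoid_of_reverse i o hI h0 h
end

section
/- Let A be an implication zroupoid. Then the following five identities are equivalent in A (each holding for all x, y, z in A): (A3) x → (y → z) ≈ (x → z) → y; (A5) x → (y → z) ≈ (y → x) → z; (A7) x → (y → z) ≈ (y → z) → x; (A8) x → (y → z) ≈ (z → x) → y; (A10) x → (y → z) ≈ (z → y) → x. Equivalently, the subvarieties of implication zroupoids defined by these identities coincide: 𝒜₃ = 𝒜₅ = 𝒜₇ = 𝒜₈ = 𝒜₁₀. -/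
namespace ImplicationZroupoid

/-! The auxiliary identities are named by their two sides in Polish notation: `iixyz` stands for
`i (i x y) z`. -/

/-- `x → (y → z) ≈ (x → z) → y` implies `x → (y → z) ≈ (y → z) → x`. -/
theorem a7_of_a3 {A : Type*} (i : A → A → A) (o : A)
    (hI : ∀ x y z : A, i (i x y) z = i (i (i (i z o) x) (i (i y z) o)) o)
    (h0 : i (i o o) o = o)
    (h : ∀ x y z : A, i x (i y z) = i (i x z) y) :
    ∀ x y z : A, i x (i y z) = i (i y z) x := by
  have ioioo_eq_o : i o (i o o) = o := by
    rw [h o o o, h0]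
  have ioixioo_eq_iox (x : A) : i o (i x (i o o)) = i o x := by
    rw [h o x (i o o), ioioo_eq_o]
  have ixioo_eq_ioioioixo (x : A) : i x (i o o) = i o (i o (i o (i x o))) := by
    rw [h x o o, hI x o o, h0, ← h o x o, ← h o o (i x o), ← h o o (i o (i x o))]
  have ixiyizu_eq_ixiyiuz (x y z u : A) : i x (i y (i z u)) = i x (i y (i u z)) := by
    rw [h y z u, h x (i y u) z, h (i x z) y u, ← h x u z, ← h x y (i u z)]
  have ioixy_eq_ioixioiyo (x y : A) : i o (i x y) = i o (i x (i o (i y o))) := by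
    rw [← ioixioo_eq_iox (i x y), ← h x (i o o) y, ← h o y o]
  have ixioo_eq_ioioioiox (x : A) : i x (i o o) = i o (i o (i o (i o x))) := by
    rw [ixioo_eq_ioioioixo x, ixiyizu_eq_ixiyiuz o o x o]
  have ixioo_eq_ioiox (x : A) : i x (i o o) = i o (i o x) := by
    rw [ixioo_eq_ioioioiox x, ixiyizu_eq_ixiyiuz o o o x, ← ioixy_eq_ioixioiyo o x]
  have ixo_eq_ioioiox (x : A) : i x o = i o (i o (i o x)) := by
    calc i x o
      _ = i x (i o (i o o)) :=
          congrArg (fun t => i x t) (ioioo_eq_o).symm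
      _ = i o (i o (i o x)) := by
          rw [h o o o, h x (i o o) o, ixioo_eq_ioioioiox (i x o), ← ioixy_eq_ioixioiyo o x]
  have ixo_eq_iox (x : A) : i x o = i o x := by
    rw [ixo_eq_ioioiox x, ← ixioo_eq_ioiox x, ioixioo_eq_iox x]
  have ixioiyo_eq_ioixy (x y : A) : i x (i o (i y o)) = i o (i x y) := by
    rw [h o y o, h x (i o o) y, hI x y (i o o), h0, ixo_eq_iox (i y (i o o)), ioixioo_eq_iox y,
      ← h o (i o y) x, ← h o x y, ixo_eq_iox (i o (i o (i x y))), ← ixo_eq_ioioiox (i x y),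
      ixo_eq_iox (i x y)]
  have ioixo_eq_ixo (x : A) : i o (i x o) = i x o := by
    rw [← ixioiyo_eq_ioixy x o, ioioo_eq_o]
  have ixo_eq_ioiox (x : A) : i x o = i o (i o x) := by
    rw [← ioixo_eq_ixo x, ixo_eq_iox x]
  have ixiyz_eq_ioiyioixioizy (x y z : A) : i x (i y z) = i o (i y (i o (i x (i o (i z y))))) := by
    rw [h x y z, hI x z y, ← h y x o, ixo_eq_iox (i z y), ← h y (i o (i z y)) (i x o),
      ← h o (i x o) (i z y), ← h x (i z y) o, ixo_eq_iox (i z y),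
      ixo_eq_iox (i y (i o (i x (i o (i z y)))))]
  have ioixy_eq_ioiyx (x y : A) : i o (i x y) = i o (i y x) := by
    rw [← ixo_eq_iox (i x y), ixo_eq_ioiox (i x y), ixiyizu_eq_ixiyiuz o o x y,
      ← ixo_eq_ioiox (i y x), ixo_eq_iox (i y x)]
  have ixiyz_eq_ioixiyz (x y z : A) : i x (i y z) = i o (i x (i y z)) := by
    calc i x (i y z)
      _ = i (i y (i o (i x (i o (i z y))))) o := by
          rw [ixiyz_eq_ioiyioixioizy x y z, ← ixo_eq_iox (i y (i o (i x (i o (i z y)))))]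
      _ = i o (i x (i y z)) := by
          rw [ixo_eq_ioiox (i y (i o (i x (i o (i z y))))), ← ixiyz_eq_ioiyioixioizy x y z]
  have ixiyz_eq_iyixz (x y z : A) : i x (i y z) = i y (i x z) := by
    rw [ixiyz_eq_ioixiyz x y z, ioixy_eq_ioiyx x (i y z), ← h y x z, ← ixiyz_eq_ioixiyz y x z]
  intro x y z
  rw [← ixiyz_eq_iyixz y x z, h y x z]

/-- `x → (y → z) ≈ (z → x) → y` implies `x → (y → z) ≈ (x → z) → y`. -/
theorem a3_of_a8 {A : Type*} (i : A → A → A) (o : A)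
    (hI : ∀ x y z : A, i (i x y) z = i (i (i (i z o) x) (i (i y z) o)) o)
    (h0 : i (i o o) o = o)
    (h : ∀ x y z : A, i x (i y z) = i (i z x) y) :
    ∀ x y z : A, i x (i y z) = i (i x z) y := by
  have ioioo_eq_o : i o (i o o) = o := by
    rw [h o o o, h0]
  have ioioiox_eq_iox (x : A) : i o (i o (i o x)) = i o x := by
    rw [h o o x, h o (i x o) o, h (i o o) x o, ioioo_eq_o]
  have ixiyizu_eq_iziuixy (x y z u : A) : i x (i y (i z u)) = i z (i u (i x y)) := by
    rw [h x y (i z u), ← h u x z, ← h (i x z) y u, ← h z (i y u) x, ← h u x y]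
  have ioixioo_eq_iox (x : A) : i o (i x (i o o)) = i o x := by
    rw [← ixiyizu_eq_iziuixy o o o x, ioioiox_eq_iox x]
  have ixioy_eq_iyiox (x y : A) : i x (i o y) = i y (i o x) := by
    rw [← ioioiox_eq_iox y, h o o y, h o (i y o) o, ← ixiyizu_eq_iziuixy y o x (i o o),
      ioixioo_eq_iox x]
  have iox_eq_ixo (x : A) : i o x = i x o := by
    rw [← ioixioo_eq_iox x, h x o o, h o (i o x) o, ← ixioy_eq_iyiox x (i o o), ioioo_eq_o]
  have ioixy_eq_iyiox (x y : A) : i o (i x y) = i y (i o x) := by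
    rw [iox_eq_ixo (i x y), ← h y o x]
  have ixioiyo_eq_ioiyioiox (x y : A) : i x (i o (i y o)) = i o (i y (i o (i o x))) := by
    rw [h o y o, h x (i o o) y, hI y x (i o o), h0, ← iox_eq_ixo (i x (i o o)), ioixioo_eq_iox x,
      ← h y (i o x) o, ← iox_eq_ixo (i o x), ← iox_eq_ixo (i y (i o (i o x)))]
  have ixo_eq_ioiox (x : A) : i x o = i o (i o x) := by
    calc i x o
      _ = i x (i o (i o o)) :=
          congrArg (fun t => i x t) (ioioo_eq_o).symm
      _ = i o (i o x) := by
          rw [ixioiyo_eq_ioiyioiox x o, ioioiox_eq_iox (i o x)]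
  have ixiyz_eq_ioiyiyioixz (x y z : A) : i x (i y z) = i o (i y (i y (i o (i x z)))) := by
    rw [h x y z, hI z x y, ← h o z y, ← iox_eq_ixo (i x y), ← h (i z y) (i o (i x y)) o,
      ← iox_eq_ixo (i o (i x y)), ← ixo_eq_ioiox (i x y), ← iox_eq_ixo (i x y),
      ← h y (i o (i x y)) z, ← h (i x y) z o, ← h y (i z o) x, ← h o x z,
      ← iox_eq_ixo (i y (i y (i o (i x z))))]
  have ioixy_eq_ixioy (x y : A) : i o (i x y) = i x (i o y) := by
    rw [← ioioiox_eq_iox (i x y), iox_eq_ixo (i x y), h o (i x y) o, h (i o o) x y,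
      ioixy_eq_iyiox (i y (i o o)) x, ioixioo_eq_iox y]
  have ioixy_eq_ioiyx (x y : A) : i o (i x y) = i o (i y x) := by
    rw [ioixy_eq_ixioy x y, ← ioixy_eq_iyiox y x]
  have ixiyz_eq_iziyx (x y z : A) : i x (i y z) = i z (i y x) := by
    rw [ixiyz_eq_ioiyiyioixz x y z, ioixy_eq_ioiyx x z, ← ixiyz_eq_ioiyiyioixz z y x]
  intro x y z
  rw [← ixiyz_eq_iziyx z y x, h z y x]

/-- `x → (y → z) ≈ (z → y) → x` implies `x → (y → z) ≈ (y → z) → x`. -/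
theorem a7_of_a10 {A : Type*} (i : A → A → A) (o : A)
    (hI : ∀ x y z : A, i (i x y) z = i (i (i (i z o) x) (i (i y z) o)) o)
    (h0 : i (i o o) o = o)
    (h : ∀ x y z : A, i x (i y z) = i (i z y) x) :
    ∀ x y z : A, i x (i y z) = i (i y z) x := by
  have iox_eq_ixo (x : A) : i o x = i x o := by
    calc i o x
      _ = i (i (i o o) o) x :=
          congrArg (fun t => i t x) (h0).symm
      _ = i x o := by
          rw [← h o o o, ← h x (i o o) o, h0]
  have iixiiiyoziiuyoo_eq_iiiiooxiiizuyoo (x y z u : A) :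
      i (i x (i (i (i y o) z) (i (i u y) o))) o = i (i (i (i o o) x) (i (i (i z u) y) o)) o := by
    rw [hI x (i (i (i y o) z) (i (i u y) o)) o, ← hI z u y]
  have iixoy_eq_iyixo (x y : A) : i (i x o) y = i y (i x o) := by
    rw [← h y o x, iox_eq_ixo x]
  have iioxo_eq_iiiixoooo (x : A) : i (i o x) o = i (i (i (i x o) o) o) o := by
    rw [hI o x o, h0, iox_eq_ixo (i (i x o) o)]
  have iixyioo_eq_iiioxiiyioooo (x y : A) :
      i (i x y) (i o o) = i (i (i o x) (i (i y (i o o)) o)) o := by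
    rw [hI x y (i o o), h0]
  have iixoy_eq_iioxy (x y : A) : i (i x o) y = i (i o x) y := by
    rw [iixoy_eq_iyixo x y, h y x o]
  have iixiooo_eq_iiiiooxiooo (x : A) : i (i x (i o o)) o = i (i (i (i o o) x) (i o o)) o := by
    rw [hI x (i o o) o, h0]
  have iiixyzu_eq_iuiiyxz (x y z u : A) : i (i (i x y) z) u = i u (i (i y x) z) := by
    rw [← h u z (i x y), h z x y]
  have iixyz_eq_iiixioziiyzoo (x y z : A) : i (i x y) z = i (i (i x (i o z)) (i (i y z) o)) o := by
    rw [hI x y z, ← h x o z]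
  have iixoy_eq_iiiiyoxiiyooo (x y : A) : i (i x o) y = i (i (i (i y o) x) (i (i y o) o)) o := by
    rw [hI x o y, iox_eq_ixo y]
  have iox_eq_iiixoxo (x : A) : i o x = i (i (i x o) x) o := by
    calc i o x
      _ = i (i (i o o) o) x :=
          congrArg (fun t => i t x) (h0).symm
      _ = i (i (i x o) x) o := by
          rw [iixoy_eq_iiiiyoxiiyooo (i o o) x, ← iixyz_eq_iiixioziiyzoo (i x o) x o]
  have o_eq_ioo : o = i o o := by
    calc o
      _ = i (i o o) o :=
          (h0).symm
      _ = i o o := by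
          rw [← iox_eq_ixo (i o o), iox_eq_iiixoxo (i o o), h0, iox_eq_ixo (i o o), h0]
  have iiiiixyzooo_eq_iiixyzo (x y z : A) : i (i (i (i (i x y) z) o) o) o = i (i (i x y) z) o := by
    calc i (i (i (i (i x y) z) o) o) o
      _ = i (i o (i (i (i x y) z) o)) o := by
          rw [← iox_eq_ixo (i (i (i x y) z) o)]
      _ = i (i (i (i o o) o) (i (i (i x y) z) o)) o :=
          congrArg (fun t => i (i t (i (i (i x y) z) o)) o) (h0).symm
      _ = i (i (i x y) z) o := by
          rw [← iixiiiyoziiuyoo_eq_iiiiooxiiizuyoo o z x y,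
            iox_eq_ixo (i (i (i z o) x) (i (i y z) o)), ← hI x y z]
  have iiioxiiiyozoo_eq_iixiiizoyiizooo (x y z : A) :
      i (i (i o x) (i (i (i y o) z) o)) o = i (i x (i (i (i z o) y) (i (i z o) o))) o := by
    calc i (i (i o x) (i (i (i y o) z) o)) o
      _ = i (i (i (i o o) x) (i (i (i y o) z) o)) o :=
          congrArg (fun t => i (i (i t x) (i (i (i y o) z) o)) o) (o_eq_ioo)
      _ = i (i x (i (i (i z o) y) (i (i z o) o))) o := by
          rw [← iixiiiyoziiuyoo_eq_iiiiooxiiizuyoo x z y o, iox_eq_ixo z]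
  have iox_eq_iiioxoo (x : A) : i o x = i (i (i o x) o) o := by
    calc i o x
      _ = i (i (i x o) x) o := by
          rw [iox_eq_iiixoxo x]
      _ = i (i (i o x) o) o := by
          rw [← iiiiixyzooo_eq_iiixyzo x o x, ← iox_eq_iiixoxo x]
  have iox_eq_iioxo (x : A) : i o x = i (i o x) o := by
    calc i o x
      _ = i (i (i o x) o) o :=
          iox_eq_iiioxoo x
      _ = i (i o x) o := by
          rw [← iox_eq_ixo (i (i o x) o), iox_eq_iiixoxo (i (i o x) o), ← iox_eq_iiioxoo x,
            h (i o x) (i o x) o, iox_eq_ixo (i o x), ← iox_eq_iiixoxo (i o x), iox_eq_ixo (i o x)]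
  have iox_eq_iixoo (x : A) : i o x = i (i x o) o := by
    rw [iox_eq_iioxo x, iox_eq_ixo x]
  have iixioyo_eq_iiioxioyo (x y : A) : i (i x (i o y)) o = i (i (i o x) (i o y)) o := by
    calc i (i x (i o y)) o
      _ = i (i (i (i o o) x) (i (i (i (i y o) o) o) o)) o := by
          rw [iox_eq_iixoo y, hI x (i (i y o) o) o]
      _ = i (i (i o x) (i o y)) o := by
          rw [← iioxo_eq_iiiixoooo y, ← o_eq_ioo, ← iox_eq_iioxo y]
  have iixyo_eq_iiyioxo (x y : A) : i (i x y) o = i (i y (i o x)) o := by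
    rw [o_eq_ioo, iixyioo_eq_iiioxiiyioooo x y, h (i o x) (i y (i o o)) o,
      iox_eq_ixo (i y (i o o)), ← o_eq_ioo, ← iox_eq_iixoo y, ← iixioyo_eq_iiioxioyo y x]
  have iixoy_eq_iiixoyo (x y : A) : i (i x o) y = i (i (i x o) y) o := by
    calc i (i x o) y
      _ = i o (i (i (i y o) x) (i (i y o) o)) := by
          rw [iixoy_eq_iiiiyoxiiyooo x y, ← iox_eq_ixo (i (i (i y o) x) (i (i y o) o))]
      _ = i (i (i x o) y) o := by
          rw [iox_eq_iioxo (i (i (i y o) x) (i (i y o) o)),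
            ← iiioxiiiyozoo_eq_iixiiizoyiizooo o x y, ← o_eq_ioo, iox_eq_ixo (i (i (i x o) y) o),
            iiiiixyzooo_eq_iiixyzo x o y]
  have iixoy_eq_iixyo (x y : A) : i (i x o) y = i (i x y) o := by
    rw [iixoy_eq_iiixoyo x y, ← h y o x, ← iixyo_eq_iiyioxo x y]
  have iixyo_eq_iyixo (x y : A) : i (i x y) o = i y (i x o) := by
    rw [← iixoy_eq_iixyo x y, iixoy_eq_iyixo x y]
  have iixyz_eq_iiiyziiozxo (x y z : A) : i (i x y) z = i (i (i y z) (i (i o z) x)) o := by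
    rw [hI x y z, iixoy_eq_iioxy z x, ← iixyo_eq_iyixo (i y z) (i (i o z) x),
      ← iox_eq_iixoo (i (i y z) (i (i o z) x)), iox_eq_ixo (i (i y z) (i (i o z) x))]
  have iixyz_eq_iiixyzo (x y z : A) : i (i x y) z = i (i (i x y) z) o := by
    calc i (i x y) z
      _ = i (i (i (i y z) (i (i o z) x)) o) o := by
          rw [hI x y z, iiixyzu_eq_iuiiyxz z o x (i (i y z) o),
            iixoy_eq_iixyo (i y z) (i (i o z) x)]
      _ = i (i (i x y) z) o := by
          rw [← iixyz_eq_iiiyziiozxo x y z]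
  have iixyz_eq_iiyxz (x y z : A) : i (i x y) z = i (i y x) z := by
    calc i (i x y) z
      _ = i (i (i x y) z) o :=
          iixyz_eq_iiixyzo x y z
      _ = i (i (i (i x y) z) o) o :=
          congrArg (fun t => i t o) (iixyz_eq_iiixyzo x y z)
      _ = i (i (i (i x y) z) (i o o)) o :=
          congrArg (fun t => i (i (i (i x y) z) t) o) (o_eq_ioo)
      _ = i (i (i (i (i y x) z) o) (i o o)) o := by
          rw [iixiooo_eq_iiiiooxiooo (i (i x y) z), ← iiixyzu_eq_iuiiyxz y x z (i o o),
            ← o_eq_ioo]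
      _ = i (i y x) z := by
          rw [← iixyz_eq_iiixyzo y x z, ← o_eq_ioo, ← iixyz_eq_iiixyzo y x z,
            ← iixyz_eq_iiixyzo y x z]
  intro x y z
  rw [h x y z, ← iixyz_eq_iiyxz y z x]

/-- `x → (y → z) ≈ (y → z) → x` implies `x → (y → z) ≈ (y → x) → z`. -/
theorem a5_of_a7 {A : Type*} (i : A → A → A) (o : A)
    (hI : ∀ x y z : A, i (i x y) z = i (i (i (i z o) x) (i (i y z) o)) o)
    (h0 : i (i o o) o = o)
    (h : ∀ x y z : A, i x (i y z) = i (i y z) x) :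
    ∀ x y z : A, i x (i y z) = i (i y x) z := by
  have iox_eq_ixo (x : A) : i o x = i x o := by
    calc i o x
      _ = i (i (i o o) o) x :=
          congrArg (fun t => i t x) (h0).symm
      _ = i x o := by
          rw [← h x (i o o) o, h0]
  have iioxy_eq_iyixo (x y : A) : i (i o x) y = i y (i x o) := by
    rw [← h y o x, iox_eq_ixo x]
  have iixiiiyoziiuyoo_eq_iiiiooxiiizuyoo (x y z u : A) :
      i (i x (i (i (i y o) z) (i (i u y) o))) o = i (i (i (i o o) x) (i (i (i z u) y) o)) o := by
    rw [hI x (i (i (i y o) z) (i (i u y) o)) o, ← hI z u y]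
  have iixoy_eq_iyiox (x y : A) : i (i x o) y = i y (i o x) := by
    rw [← h y x o, ← iox_eq_ixo x]
  have iioxo_eq_iixoo (x : A) : i (i o x) o = i (i x o) o := by
    rw [iioxy_eq_iyixo x o, iox_eq_ixo (i x o)]
  have ixiyo_eq_ixioy (x y : A) : i x (i y o) = i x (i o y) := by
    rw [← iioxy_eq_iyixo y x, ← h x o y]
  have iioxy_eq_iixoy (x y : A) : i (i o x) y = i (i x o) y := by
    rw [iioxy_eq_iyixo x y, h y x o]
  have iixoo_eq_iiiiooxoo (x : A) : i (i x o) o = i (i (i (i o o) x) o) o := by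
    rw [hI x o o, h0]
  have iixiyzu_eq_iuiiyzx (x y z u : A) : i (i x (i y z)) u = i u (i (i y z) x) := by
    rw [← h u x (i y z), h x y z]
  have iixyz_eq_iiiiyzoiizoxo (x y z : A) : i (i x y) z = i (i (i (i y z) o) (i (i z o) x)) o := by
    rw [hI x y z, h (i (i z o) x) (i y z) o]
  have iixiyoz_eq_iziioyx (x y z : A) : i (i x (i y o)) z = i z (i (i o y) x) := by
    rw [← h z x (i y o), ← iioxy_eq_iyixo y x]
  have iixyz_eq_iiixizoiiyzoo (x y z : A) : i (i x y) z = i (i (i x (i z o)) (i (i y z) o)) o := by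
    rw [hI x y z, ← h x z o]
  have iixoy_eq_iiiiyoxiiyooo (x y : A) : i (i x o) y = i (i (i (i y o) x) (i (i y o) o)) o := by
    rw [hI x o y, iox_eq_ixo y]
  have iox_eq_iiixoxo (x : A) : i o x = i (i (i x o) x) o := by
    calc i o x
      _ = i (i (i o o) o) x :=
          congrArg (fun t => i t x) (h0).symm
      _ = i (i (i x o) x) o := by
          rw [iixoy_eq_iiiiyoxiiyooo (i o o) x, ← iixyz_eq_iiixizoiiyzoo (i x o) x o]
  have o_eq_ioo : o = i o o := by
    calc o
      _ = i (i o o) o :=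
          (h0).symm
      _ = i o o := by
          rw [← iox_eq_ixo (i o o), iox_eq_iiixoxo (i o o), h0, iox_eq_ixo (i o o), h0]
  have iixoo_eq_iox (x : A) : i (i x o) o = i o x := by
    rw [iixoo_eq_iiiiooxoo x, ← iox_eq_ixo (i (i (i o o) x) o),
      iox_eq_iiixoxo (i (i (i o o) x) o), ← iixoo_eq_iiiiooxoo x,
      h (i (i x o) o) (i (i o o) x) o, ← iixyz_eq_iiiiyzoiizoxo o (i o o) x, iox_eq_ixo (i o o),
      h0]
  have iox_eq_iioxo (x : A) : i o x = i (i o x) o := by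
    calc i o x
      _ = i (i x o) o := by
          rw [← iixoo_eq_iox x]
      _ = i (i o x) o := by
          rw [← iox_eq_ixo x]
  have iixyz_eq_iiixyzo (x y z : A) : i (i x y) z = i (i (i x y) z) o := by
    calc i (i x y) z
      _ = i o (i (i (i z o) x) (i (i y z) o)) := by
          rw [hI x y z, ← iox_eq_ixo (i (i (i z o) x) (i (i y z) o))]
      _ = i (i (i x y) z) o := by
          rw [← iixoo_eq_iox (i (i (i z o) x) (i (i y z) o)), ← hI x y z]
  have iixyo_eq_iioxioy (x y : A) : i (i x y) o = i (i o x) (i o y) := by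
    rw [hI x y o, ← iioxo_eq_iixoo y, ← o_eq_ioo, ← iox_eq_iioxo y,
      ← iixyz_eq_iiixyzo o x (i o y)]
  have iixyo_eq_iiyxo (x y : A) : i (i x y) o = i (i y x) o := by
    rw [iixyo_eq_iioxioy x y, h (i o x) o y, ← iixyo_eq_iioxioy y x]
  have iixoy_eq_iixyo (x y : A) : i (i x o) y = i (i x y) o := by
    rw [iixyz_eq_iiixyzo x o y, iixyo_eq_iioxioy (i x o) y, ← iioxy_eq_iyixo x o,
      ← iox_eq_iioxo x, ← iixyo_eq_iioxioy x y]
  have iioxy_eq_iixyo (x y : A) : i (i o x) y = i (i x y) o := by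
    rw [iixyz_eq_iiixyzo o x y, iixyo_eq_iioxioy (i o x) y, ← iixoy_eq_iyiox x o, iixoo_eq_iox x,
      ← iixyo_eq_iioxioy x y]
  have iixoy_eq_iiyxo (x y : A) : i (i x o) y = i (i y x) o := by
    rw [iixyz_eq_iiixyzo x o y, iixyo_eq_iioxioy (i x o) y, iixiyoz_eq_iziioyx o x (i o y),
      ← iox_eq_iioxo x, ← iixyo_eq_iioxioy y x]
  have iixyo_eq_iyixo (x y : A) : i (i x y) o = i y (i x o) := by
    rw [← iixoy_eq_iixyo x y, ← h y x o]
  have iixyo_eq_iyiox (x y : A) : i (i x y) o = i y (i o x) := by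
    rw [← iixoy_eq_iixyo x y, iixoy_eq_iyiox x y]
  have iiixyoz_eq_iixyz (x y z : A) : i (i (i x y) o) z = i (i x y) z := by
    rw [iixyo_eq_iyixo x y, ← h z y (i x o), ixiyo_eq_ixioy y x, ← iixyo_eq_iyiox x y,
      ← iixyo_eq_iyixo (i x y) z, ← iixyz_eq_iiixyzo x y z]
  have iixyz_eq_iiyxz (x y z : A) : i (i x y) z = i (i y x) z := by
    rw [iixyz_eq_iiixyzo x y z, iixyo_eq_iyixo (i x y) z, iixyo_eq_iiyxo x y,
      ← iixyo_eq_iyixo (i y x) z, ← iixyz_eq_iiixyzo y x z]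
  have iixoy_eq_iiiyoxy (x y : A) : i (i x o) y = i (i (i y o) x) y := by
    rw [hI x o y, iioxy_eq_iixoy y o, iixoo_eq_iox y, ← iixyo_eq_iyiox y (i (i y o) x),
      h y (i y o) x, ← iixyz_eq_iiixyzo (i y o) x y, ← iixyz_eq_iiixyzo (i y o) x y]
  have iixiyzo_eq_iizyx (x y z : A) : i (i x (i y z)) o = i (i z y) x := by
    rw [hI x (i y z) o, ← iixiiiyoziiuyoo_eq_iiiiooxiiizuyoo x o y z, ← iioxy_eq_iixoy z o,
      ← o_eq_ioo, ← iox_eq_iioxo z, iioxy_eq_iixyo y (i o z), ← iixyo_eq_iyiox z y,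
      iixoo_eq_iox (i z y), iox_eq_ixo (i z y), ← iixyo_eq_iyixo (i z y) x,
      ← iixyz_eq_iiixyzo z y x, ← iixyz_eq_iiixyzo z y x]
  have ixiiyoz_eq_iiyzx (x y z : A) : i x (i (i y o) z) = i (i y z) x := by
    rw [← iixiyzu_eq_iuiiyzx z y o x, ← iox_eq_ixo y, ← iixyo_eq_iyiox y z,
      iiixyoz_eq_iixyz y z x]
  have iixoy_eq_iixyy (x y : A) : i (i x o) y = i (i x y) y := by
    rw [iixoy_eq_iiiyoxy x y, iixoy_eq_iiyxo y x, iiixyoz_eq_iixyz x y y]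
  have iixyz_eq_iizxiyz (x y z : A) : i (i x y) z = i (i z x) (i y z) := by
    rw [hI x y z, ← iixiyzu_eq_iuiiyzx o y z (i (i z o) x), iox_eq_ixo (i y z),
      iixoy_eq_iixyo (i y z) (i (i z o) x), ixiiyoz_eq_iiyzx (i y z) z x,
      ← iixyz_eq_iiixyzo z x (i y z), ← iixyz_eq_iiixyzo z x (i y z)]
  have iixyz_eq_iizyx (x y z : A) : i (i x y) z = i (i z y) x := by
    rw [iixyz_eq_iizxiyz x y z, iixyz_eq_iizxiyz z x (i y z), ← iixoy_eq_iixyy y z,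
      h (i (i y o) z) x (i y z), ixiiyoz_eq_iiyzx (i x (i y z)) y z, h (i y z) x (i y z),
      ← iixoy_eq_iixyy x (i y z), iixoy_eq_iixyo x (i y z), iixiyzo_eq_iizyx x y z]
  have iixyz_eq_ixizy (x y z : A) : i (i x y) z = i x (i z y) := by
    rw [← iixyz_eq_iizyx z y x, ← h x z y]
  intro x y z
  rw [← iixyz_eq_ixizy x z y, iixyz_eq_iiyxz x z y, ← iixyz_eq_iizyx y x z]

/-- Under `x → (y → z) ≈ (y → x) → z`, a product `(x → y) → z` is invariant under
permutations of its three factors. -/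
theorem right_comm_and_left_swap_of_a5 {A : Type*} (i : A → A → A) (o : A)
    (hI : ∀ x y z : A, i (i x y) z = i (i (i (i z o) x) (i (i y z) o)) o)
    (h0 : i (i o o) o = o)
    (h : ∀ x y z : A, i x (i y z) = i (i y x) z) :
    (∀ x y z : A, i (i x y) z = i (i x z) y) ∧ ∀ x y z : A, i (i x y) z = i (i y x) z := by
  have iiiooxo_eq_ixo (x : A) : i (i (i o o) x) o = i x o := by
    rw [← h x (i o o) o, h0]
  have iioxo_eq_iiiixoooo (x : A) : i (i o x) o = i (i (i (i x o) o) o) o := by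
    rw [hI o x o, h0, h o (i x o) o]
  have iiioxoo_eq_ixo (x : A) : i (i (i o x) o) o = i x o := by
    rw [iioxo_eq_iiiixoooo x, ← h o (i (i x o) o) o, iioxo_eq_iiiixoooo (i (i (i x o) o) o),
      ← iioxo_eq_iiiixoooo x, ← iioxo_eq_iiiixoooo (i o x), h o o x, iiiooxo_eq_ixo x]
  have ixo_eq_iiixooo (x : A) : i x o = i (i (i x o) o) o := by
    calc i x o
      _ = i (i (i (i (i o x) o) o) o) o := by
          rw [← iiiooxo_eq_ixo x, ← h o o x, iioxo_eq_iiiixoooo (i o x)]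
      _ = i (i (i x o) o) o := by
          rw [iiioxoo_eq_ixo x]
  have iiixoyo_eq_iiiioyxoo (x y : A) : i (i (i x o) y) o = i (i (i (i o y) x) o) o := by
    rw [← h o x y, ← h (i x y) o o, hI x y (i o o), h0, h y o o, iiioxoo_eq_ixo y, h (i o x) y o,
      h y o x]
  have ioo_eq_o : i o o = o := by
    calc i o o
      _ = i (i (i o o) o) o :=
          congrArg (fun t => i t o) (h0).symm
      _ = o := by
          rw [iiixoyo_eq_iiiioyxoo o o, h0, h0]
  have ixo_eq_iixoo (x : A) : i x o = i (i x o) o := by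
    calc i x o
      _ = i (i (i (i o o) x) o) o := by
          rw [ixo_eq_iiixooo x, iiixoyo_eq_iiiioyxoo x o]
      _ = i (i x o) o := by
          rw [iiiooxo_eq_ixo x]
  have ixo_eq_iioxo (x : A) : i x o = i (i o x) o := by
    rw [ixo_eq_iixoo x, hI x o o, h0, ioo_eq_o, ← ixo_eq_iixoo (i o x)]
  have iixyz_eq_iiiiizyozxo (x y z : A) : i (i x y) z = i (i (i (i (i z y) o) z) x) o := by
    rw [hI x y z, h (i (i z o) x) (i y z) o, h (i y z) (i z o) x, h (i z o) y z, h y z o,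
      ← ixo_eq_iixoo (i (i (i (i z y) o) z) x)]
  have iox_eq_iiioxxo (x : A) : i o x = i (i (i o x) x) o := by
    calc i o x
      _ = i (i o o) x :=
          congrArg (fun t => i t x) (ioo_eq_o).symm
      _ = i o (i o x) := by
          rw [← h o o x]
      _ = i (i o o) (i o x) :=
          congrArg (fun t => i t (i o x)) (ioo_eq_o).symm
      _ = i (i (i o x) x) o := by
          rw [iixyz_eq_iiiiizyozxo o o (i o x), ← iixyz_eq_iiiiizyozxo (i o x) x o,
            ← ixo_eq_iixoo (i (i o x) x)]
  have iox_eq_ixo (x : A) : i o x = i x o := by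
    rw [iox_eq_iiioxxo x, ixo_eq_iixoo (i (i o x) x), ← iox_eq_iiioxxo x, ← ixo_eq_iioxo x]
  have iixyo_eq_iixoy (x y : A) : i (i x y) o = i (i x o) y := by
    rw [← iox_eq_ixo (i x y), h o x y]
  have iixyz_eq_iiixyzo (x y z : A) : i (i x y) z = i (i (i x y) z) o := by
    calc i (i x y) z
      _ = i (i (i (i (i z y) o) z) x) o := by
          rw [iixyz_eq_iiiiizyozxo x y z]
      _ = i (i (i x y) z) o := by
          rw [ixo_eq_iixoo (i (i (i (i z y) o) z) x), ← iixyz_eq_iiiiizyozxo x y z]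
  have iixyz_eq_iiiyxoz (x y z : A) : i (i x y) z = i (i (i y x) o) z := by
    rw [iixyz_eq_iiixyzo x y z, ← h y x z, iixyo_eq_iixoy y (i x z), h (i y o) x z, h x y o]
  have iixyz_eq_iiixozy (x y z : A) : i (i x y) z = i (i (i x o) z) y := by
    rw [iixyz_eq_iiixyzo x y z, ← h z (i x y) o, iixyo_eq_iixoy x y, h z (i x o) y]
  have iixyz_eq_iixzy (x y z : A) : i (i x y) z = i (i x z) y := by
    rw [iixyz_eq_iiixyzo x y z, iixyo_eq_iixoy (i x y) z, iixyo_eq_iixoy x y,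
      ← iixyz_eq_iiixozy x z y]
  have iixyz_eq_iiizzyx (x y z : A) : i (i x y) z = i (i (i z z) y) x := by
    rw [iixyz_eq_iiiiizyozxo x y z, iixyo_eq_iixoy z y, ← iixyz_eq_iiixozy z z y,
      ← iixyz_eq_iiixyzo (i z z) y x]
  have iixyz_eq_iiyxz (x y z : A) : i (i x y) z = i (i y x) z := by
    rw [iixyz_eq_iiiyxoz x y z, ← h x y o, ← h (i y o) x z, iixyz_eq_iiiiizyozxo y o (i x z),
      iixyo_eq_iixoy x z, h (i (i (i x o) z) o) x z, h x (i (i x o) z) o,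
      ← iixyz_eq_iiixozy x x z, ← iixyz_eq_iiixyzo x x z, ← iixyz_eq_iiizzyx z z x,
      ← iixyz_eq_iiizzyx y x z, ← iixyz_eq_iiixyzo y x z]
  exact ⟨iixyz_eq_iixzy, iixyz_eq_iiyxz⟩

end ImplicationZroupoid

/-- In any implication zroupoid, the identities (A3), (A5), (A7),
    (A8), (A10) are mutually equivalent; i.e., 𝒜₃ = 𝒜₅ = 𝒜₇ = 𝒜₈ = 𝒜₁₀. -/
theorem stmt_10 {A : Type*} (i : A → A → A) (o : A)
    (hI : ∀ x y z : A, i (i x y) z = i (i (i (i z o) x) (i (i y z) o)) o)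
    (h0 : i (i o o) o = o) :
    [(∀ x y z : A, i x (i y z) = i (i x z) y),    -- (A3)
     (∀ x y z : A, i x (i y z) = i (i y x) z),    -- (A5)
     (∀ x y z : A, i x (i y z) = i (i y z) x),    -- (A7)
     (∀ x y z : A, i x (i y z) = i (i z x) y),    -- (A8)
     (∀ x y z : A, i x (i y z) = i (i z y) x)].TFAE := by  -- (A10)
  have from_a5 (h : ∀ x y z : A, i x (i y z) = i (i y x) z) :=
    ImplicationZroupoid.right_comm_and_left_swap_of_a5 i o hI h0 h
  tfae_have 1 → 3 := ImplicationZroupoid.a7_of_a3 i o hI h0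
  tfae_have 3 → 2 := ImplicationZroupoid.a5_of_a7 i o hI h0
  tfae_have 4 → 1 := ImplicationZroupoid.a3_of_a8 i o hI h0
  tfae_have 5 → 3 := ImplicationZroupoid.a7_of_a10 i o hI h0
  tfae_have 2 → 1 := by
    intro h x y z
    obtain ⟨right_comm, left_swap⟩ := from_a5 h
    rw [h, left_swap, right_comm]
  tfae_have 2 → 4 := by
    intro h x y z
    obtain ⟨right_comm, left_swap⟩ := from_a5 h
    rw [h, right_comm, left_swap z x, right_comm x, left_swap x y, right_comm]
  tfae_have 2 → 5 := by
    intro h x y z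
    obtain ⟨right_comm, left_swap⟩ := from_a5 h
    rw [h, right_comm, left_swap]
  tfae_finish
end

section
/- Let A be an implication zroupoid satisfying the identity (A13): (x → y) → z ≈ (y → z) → x (for all x, y, z in A). Then A satisfies the identities: (a) (x → y)' ≈ (0 → x) → y; (b) (x → y)' ≈ x' → y'; (c) (x → y)' ≈ (0 → y) → x'; (d) (x → y)' ≈ (x → y)''; (e) (x → y)' ≈ (y → x)' (for all x, y in A). -/
/-- In any implication zroupoid satisfying (A13): (x → y) → z ≈ (y → z) → x,
    the identities (a) (x → y)' ≈ (0 → x) → y, (b) (x → y)' ≈ x' → y',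
    (c) (x → y)' ≈ (0 → y) → x', (d) (x → y)' ≈ (x → y)'', (e) (x → y)' ≈ (y → x)' hold. -/
theorem stmt_11 {A : Type*} (i : A → A → A) (o : A)
    (hI : ∀ x y z : A, i (i x y) z = i (i (i (i z o) x) (i (i y z) o)) o)
    (h0 : i (i o o) o = o)
    (hA13 : ∀ x y z : A, i (i x y) z = i (i y z) x) :
    (∀ x y : A, i (i x y) o = i (i o x) y) ∧
    (∀ x y : A, i (i x y) o = i (i x o) (i y o)) ∧
    (∀ x y : A, i (i x y) o = i (i o y) (i x o)) ∧
    (∀ x y : A, i (i x y) o = i (i (i x y) o) o) ∧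
    (∀ x y : A, i (i x y) o = i (i y x) o) := by
  have swap : ∀ x y, i (i y o) x = i (i x y) o := fun x y => (hA13 x y o).symm
  have hA : ∀ x y, i (i x y) o = i (i o x) y := fun x y => (hA13 o x y).symm
  have prime_prime : ∀ x y, i (i x o) (i y o) = i (i (i x y) o) o := fun x y => by
    rw [swap (i y o) x, swap x y]
  have prime_five : ∀ x y, i (i x y) o = i (i (i (i (i (i x y) o) o) o) o) o := fun x y => by
    have h := hI x y o
    have h1 : i (i o o) x = i (i x o) o := swap x o
    rwa [h1, prime_prime, prime_prime] at h
  have mul_mul : ∀ x y z, i (i x y) z = i (i (i (i (i x z) (i y z)) o) o) o := fun x y z => by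
    rw [hI x y z, swap x z, prime_prime]
  have zero_mul_eq : ∀ z, i o z = i (i z (i z o)) o := fun z => by
    have h := mul_mul (i o o) o z
    rwa [h0, swap z o, swap (i o z) (i z o), hA13 o z (i z o), ← prime_five] at h
  have zero_mul_self : ∀ z, i o z = i (i (i z o) o) z := fun z => by
    rw [zero_mul_eq, swap z (i z o)]
  have zero_prime : i o o = o := by
    have h1 : i o (i o o) = i o o := by rw [zero_mul_self, h0, swap, h0]
    have h2 := hA13 (i o o) (i o o) o
    rw [h0, h1, swap, h0, h0] at h2
    exact h2.symm
  have zero_mul : ∀ z, i o z = i (i z o) o := fun z => by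
    simpa only [zero_prime] using swap z o
  have prime_mul_prime : ∀ x y, i (i x y) o = i (i y (i x o)) o := fun x y => by
    rw [hA, zero_mul, swap]
  have triple : ∀ z, i (i (i z o) o) o = i (i z o) o := fun z => by
    rw [← zero_mul z, prime_mul_prime o z, zero_prime, zero_mul]
  have hD : ∀ x y, i (i x y) o = i (i (i x y) o) o := fun x y => by
    simpa only [triple] using prime_five x y
  have hE : ∀ x y, i (i x y) o = i (i y x) o := fun x y => by
    have h1 : i (i (i x o) o) (i y o) = i (i y x) o := by
      rw [prime_prime, swap y x, ← hD, ← hD]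
    have h2 : i (i (i x o) o) (i y o) = i (i x y) o := by
      rw [← triple x, prime_prime, ← zero_mul x, ← hA x y, ← hD, ← hD]
    rw [← h1, h2]
  refine ⟨hA, fun x y => ?_, fun x y => ?_, hD, hE⟩
  · rw [prime_prime, ← hD]
  · rw [zero_mul, prime_prime, swap x y, ← hD, ← hD]
end

section
/- Let A be an implication zroupoid. Then the following three identities are equivalent in A (each holding for all x, y, z in A): (A11) (x → y) → z ≈ (x → z) → y; (A12) (x → y) → z ≈ (y → x) → z; (A13) (x → y) → z ≈ (y → z) → x. Equivalently, the subvarieties of implication zroupoids defined by these identities coincide: 𝒜₁₁ = 𝒜₁₂ = 𝒜₁₃. -/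
/-- In an implication zroupoid, (A11) implies (A12). -/
theorem imp_antecedent_comm_of_right_comm {A : Type*} (i : A → A → A) (o : A)
    (hI : ∀ x y z : A, i (i x y) z = i (i (i (i z o) x) (i (i y z) o)) o)
    (h0 : i (i o o) o = o)
    (h : ∀ x y z : A, i (i x y) z = i (i x z) y) (x y z : A) :
    i (i x y) z = i (i y x) z := by
  have zero_self : i o o = o := by grind
  have zero_imp_neg : ∀ x y, i (i o x) y = i (i y x) o := by grind
  have zero_imp_comm : ∀ x y, i o (i x y) = i o (i y x) := by grind
  have zero_imp_imp : ∀ x y z, i o (i (i x y) z) = i (i x y) z := by grind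
  grind

/-- In an implication zroupoid, (A12) implies (A11). -/
theorem imp_right_comm_of_antecedent_comm {A : Type*} (i : A → A → A) (o : A)
    (hI : ∀ x y z : A, i (i x y) z = i (i (i (i z o) x) (i (i y z) o)) o)
    (h0 : i (i o o) o = o)
    (h : ∀ x y z : A, i (i x y) z = i (i y x) z) (x y z : A) :
    i (i x y) z = i (i x z) y := by
  have swap_inner : ∀ x y z u, i (i (i x y) z) u = i (i z (i y x)) u := by
    clear * - h
    grind
  have zero_self : i o o = o := by
    clear * - h0 h hI
    grind
  have neg_left : ∀ x y, i (i (i x o) y) o = i (i x y) o := by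
    clear * - h0 h swap_inner hI zero_self
    grind
  have zero_imp_right : ∀ x y, i (i y (i o x)) o = i (i x y) o := by
    clear * - swap_inner neg_left
    grind
  have absorb : ∀ x y, i (i x (i y x)) o = i (i o y) x := by
    clear * - h hI neg_left zero_imp_right
    grind
  have neg_self : ∀ x, i (i x x) o = i o x := by
    clear * - zero_self zero_imp_right absorb
    grind
  have zero_neg : ∀ x, i o (i x o) = i o x := by
    clear * - h neg_left neg_self
    grind
  have zero_zero_imp : ∀ x, i o (i o x) = i o x := by
    clear * - h neg_left zero_imp_right neg_self
    grind
  have neg_zero_imp : ∀ x, i (i o x) o = i o x := by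
    clear * - h swap_inner zero_self neg_left zero_imp_right absorb neg_self zero_neg zero_zero_imp
    grind
  have zero_imp_eq : ∀ x y, i (i o x) y = i (i y x) y := by
    clear * - h swap_inner hI zero_self zero_imp_right absorb neg_self zero_zero_imp
    grind
  have zero_imp_neg : ∀ x y, i (i o x) y = i (i x y) o := by
    clear * - h swap_inner neg_left absorb zero_imp_eq
    grind
  have zero_imp_assoc : ∀ x y, i (i o x) y = i o (i x y) := by
    clear * - h zero_zero_imp neg_zero_imp zero_imp_neg
    grind
  have imp_self : ∀ x y, i (i y x) y = i o (i x y) := by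
    clear * - zero_imp_eq zero_imp_assoc
    grind
  have zero_imp_imp : ∀ x y z, i o (i (i x y) z) = i (i x y) z := by
    clear * - h swap_inner hI neg_left zero_neg zero_zero_imp zero_imp_neg zero_imp_assoc
    grind
  have zero_imp_rev : ∀ x y z, i o (i x (i y z)) = i (i z y) x := by
    clear * - h swap_inner hI neg_left zero_neg zero_zero_imp zero_imp_neg zero_imp_assoc
    grind
  have drop_zero : ∀ x y z, i (i x (i o y)) z = i (i x y) z := by
    clear * - h0 h swap_inner hI zero_self neg_zero_imp zero_imp_neg zero_imp_assoc
    grind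
  have distrib : ∀ x y z u, i (i x y) (i (i z u) y) = i (i x (i z u)) y := by
    clear * - h swap_inner hI zero_imp_neg zero_imp_assoc zero_imp_imp zero_imp_rev
    grind
  have drop_inner : ∀ x y z, i (i x (i z y)) z = i (i x y) z := by
    clear * - h0 h swap_inner hI zero_self neg_zero_imp zero_imp_neg zero_imp_assoc imp_self
    grind
  have merge : ∀ x y z, i (i x y) (i z y) = i (i x z) y := by
    clear * - h swap_inner hI neg_left zero_neg zero_imp_neg zero_imp_assoc drop_zero distrib
    grind
  have drop_last : ∀ x y z, i (i (i z y) x) z = i (i x y) z := by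
    clear * - h drop_inner
    grind
  clear * - h zero_imp_eq zero_imp_assoc imp_self zero_imp_imp zero_imp_rev merge drop_last
  grind

/-- In an implication zroupoid, (A13) implies (A11). -/
theorem imp_right_comm_of_rotate {A : Type*} (i : A → A → A) (o : A)
    (hI : ∀ x y z : A, i (i x y) z = i (i (i (i z o) x) (i (i y z) o)) o)
    (h0 : i (i o o) o = o)
    (h : ∀ x y z : A, i (i x y) z = i (i y z) x) (x y z : A) :
    i (i x y) z = i (i x z) y := by
  have key : ∀ x y z, i o (i x (i y z)) = i (i x z) y := by grind
  grind

/-- In any implication zroupoid, the identities (A11), (A12), (A13)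
    are mutually equivalent; i.e., 𝒜₁₁ = 𝒜₁₂ = 𝒜₁₃. -/
theorem stmt_12 {A : Type*} (i : A → A → A) (o : A)
    (hI : ∀ x y z : A, i (i x y) z = i (i (i (i z o) x) (i (i y z) o)) o)
    (h0 : i (i o o) o = o) :
    [(∀ x y z : A, i (i x y) z = i (i x z) y),    -- (A11)
     (∀ x y z : A, i (i x y) z = i (i y x) z),    -- (A12)
     (∀ x y z : A, i (i x y) z = i (i y z) x)].TFAE := by  -- (A13)
  have h12 := imp_antecedent_comm_of_right_comm i o hI h0
  have h21 := imp_right_comm_of_antecedent_comm i o hI h0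
  have h31 := imp_right_comm_of_rotate i o hI h0
  tfae_have 1 → 2 := h12
  tfae_have 2 → 1 := h21
  tfae_have 3 → 1 := h31
  tfae_have 1 → 3 := fun h x y z => by rw [h12 h x y z, h y x z]
  tfae_finish
end

section
/- Let A be an implication zroupoid that satisfies at least one of the identities (A2): x → (y → z) ≈ x → (z → y), (A6): x → (y → z) ≈ y → (z → x), or (A9): x → (y → z) ≈ z → (y → x) (each for all x, y, z in A). Then A satisfies the identity (A11): (x → y) → z ≈ (x → z) → y (for all x, y, z in A). -/
theorem right_comm_of_inner_comm {A : Type*} (i : A → A → A) (o : A)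
    (hI : ∀ x y z : A, i (i x y) z = i (i (i (i z o) x) (i (i y z) o)) o)
    (h0 : i (i o o) o = o)
    (h : ∀ x y z : A, i x (i y z) = i x (i z y)) :
    ∀ x y z : A, i (i x y) z = i (i x z) y := by
  have imp_imp_eq : ∀ x y z : A, i (i (i (i x o) y) (i o (i z x))) o = i (i y z) x := by
    intro x y z
    grind only [h (i (i x o) y) (i z x) o, hI y z x]
  have neg_neg_zz_imp : ∀ x : A, i (i (i (i o o) x) o) o = i (i x o) o := by
    intro x
    grind only [h (i (i o o) x) (i o o) o, imp_imp_eq o x o]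
  have neg_zero : i o o = o := by
    grind only [neg_neg_zz_imp (i o o), imp_imp_eq (i o o) o o, h o (i o o) o]
  have neg_neg_imp_imp : ∀ x y z : A, i (i (i (i x y) z) o) o = i (i (i x y) z) o := by
    intro x y z
    grind only [imp_imp_eq z x y, imp_imp_eq o (i (i (i (i z o) x) (i o (i y z))) (i o o)) o,
      h (i o o) (i (i (i z o) x) (i o (i y z))) (i o o),
      imp_imp_eq o (i (i o o) (i (i (i z o) x) (i o (i y z)))) o,
      neg_neg_zz_imp (i (i (i z o) x) (i o (i y z)))]
  have neg_imp_imp : ∀ x y z : A, i (i (i x y) z) o = i (i x y) z := by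
    intro x y z
    grind only [imp_imp_eq z x y, neg_neg_imp_imp (i z o) x (i o (i y z))]
  have left_comm : ∀ x y z : A, i (i x y) z = i (i y x) z := by
    intro x y z
    grind only [neg_imp_imp x y z, imp_imp_eq o (i x y) z, h (i o o) y x, imp_imp_eq o (i y x) z,
      neg_imp_imp y x z]
  have neg_zero_imp : ∀ x : A, i (i o x) o = i o x := by
    intro x
    grind only [neg_imp_imp o o x]
  have neg_imp_eq : ∀ x y : A, i (i (i o x) (i o (i y o))) o = i (i x y) o := by
    intro x y
    grind only [imp_imp_eq o x y]
  have neg_zero_imp_imp : ∀ x y : A, i (i o (i x y)) o = i (i x y) o := by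
    intro x y
    grind only [neg_neg_imp_imp o o (i x y), neg_neg_zz_imp (i x y), neg_imp_eq x y,
      neg_neg_imp_imp o x (i o (i y o))]
  have zero_imp_imp_eq : ∀ x y z : A, i o (i x (i y z)) = i (i y z) x := by
    intro x y z
    grind only [neg_zero_imp (i x (i y z)), h o x (i y z), neg_zero_imp_imp (i y z) x,
      neg_imp_imp y z x]
  have zero_imp_imp : ∀ x y : A, i (i o x) y = i o (i y x) := by
    intro x y
    grind only [zero_imp_imp_eq y o x, neg_zero_imp (i y (i o x)), neg_zero_imp_imp y (i o x),
      neg_imp_eq y (i o x), h (i o y) o (i (i o x) o), neg_neg_zz_imp x, h (i o y) (i x o) o,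
      neg_imp_eq y x, neg_zero_imp_imp y x, neg_zero_imp (i y x)]
  have neg_imp : ∀ x y : A, i (i x o) y = i o (i y x) := by
    intro x y
    grind only [zero_imp_imp_eq y x o, neg_zero_imp (i y (i x o)), neg_zero_imp_imp y (i x o),
      neg_imp_eq y (i x o), neg_neg_zz_imp x, neg_neg_imp_imp o o x, h (i o y) (i (i o x) o) o,
      h (i o y) (i x o) o, neg_imp_eq y x, neg_zero_imp_imp y x, neg_zero_imp (i y x)]
  have imp_imp_imp_self : ∀ x y z : A, i (i x y) (i z y) = i (i x z) y := by
    intro x y z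
    grind only [zero_imp_imp_eq (i z y) x y, zero_imp_imp_eq (i x y) z y,
      zero_imp_imp (i z y) (i x y), zero_imp_imp (i x y) (i o (i z y)), neg_imp y x,
      neg_imp_imp (i y o) x (i o (i z y)), imp_imp_eq y x z]
  have zero_imp_zero_imp : ∀ x : A, i o (i o x) = i o x := by
    intro x
    grind only [neg_zero_imp (i o x), neg_zero_imp_imp o (i o x), h o o (i o x),
      neg_zero_imp_imp (i o x) o, neg_zero_imp x]
  intro x y z
  grind only [left_comm y x z, imp_imp_imp_self y z x, imp_imp_imp_self y (i x z) z,
    h (i y (i x z)) z (i x z), zero_imp_imp_eq z x z, h o (i x z) z, zero_imp_imp (i x z) z,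
    zero_imp_imp z x, left_comm (i o z) x z, zero_imp_imp z (i x (i o z)), zero_imp_zero_imp z,
    imp_imp_imp_self o (i o z) x, zero_imp_imp x (i o z), zero_imp_zero_imp (i x z),
    zero_imp_imp_eq (i o (i x z)) y (i x z), zero_imp_imp (i y (i x z)) (i o (i x z)),
    zero_imp_imp (i x z) y, left_comm (i o (i x z)) y (i o (i x z)),
    imp_imp_imp_self y (i o (i x z)) o, neg_imp y (i o (i x z)), zero_imp_zero_imp (i y (i x z)),
    zero_imp_imp_eq y x z]

theorem right_comm_of_rotate {A : Type*} (i : A → A → A) (o : A)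
    (hI : ∀ x y z : A, i (i x y) z = i (i (i (i z o) x) (i (i y z) o)) o)
    (h0 : i (i o o) o = o)
    (h : ∀ x y z : A, i x (i y z) = i y (i z x)) :
    ∀ x y z : A, i (i x y) z = i (i x z) y := by
  have imp_imp_eq : ∀ x y z : A, i (i o (i x (i (i (i x o) y) z))) o = i (i y z) x := by
    intro x y z
    grind only [h x (i (i x o) y) z, h o (i (i x o) y) (i z x), hI y z x]
  have zero_imp_imp_zz : ∀ x : A, i o (i x (i o o)) = i x o := by
    intro x
    grind only [h (i o o) o x, h x (i o o) o]
  have zero_imp_zero_imp_imp_imp : ∀ x y z : A, i o (i o (i (i x y) z)) = i (i x y) z := by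
    intro x y z
    grind only [imp_imp_eq z x y, h o (i o (i z (i (i (i z o) x) y))) o,
      zero_imp_imp_zz (i o (i z (i (i (i z o) x) y)))]
  have zero_imp_zz : i o (i o o) = o := by
    grind only [zero_imp_imp_zz o, h (i o o) o o, zero_imp_imp_zz (i o o)]
  have neg_eq : ∀ x : A, i x o = i o x := by
    intro x
    grind only [zero_imp_imp_zz x, h x o o, zero_imp_zero_imp_imp_imp o (i o o) x]
  have zero_imp_zero_imp_imp : ∀ x y : A, i o (i o (i x y)) = i (i o x) y := by
    intro x y
    grind only [h (i x y) o o, imp_imp_eq (i o o) x y, zero_imp_zero_imp_imp_imp o o (i (i o x) y),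
      h (i (i o x) y) o (i o o), neg_eq (i (i o x) y), zero_imp_zero_imp_imp_imp o x y,
      neg_eq (i o (i (i o x) y))]
  have zero_imp_imp : ∀ x y : A, i (i o x) y = i o (i x y) := by
    intro x y
    grind only [zero_imp_zero_imp_imp x y, neg_eq (i o (i x y)), zero_imp_zero_imp_imp (i x y) o,
      h o (i x y) o, zero_imp_imp_zz (i x y), neg_eq (i x y)]
  have imp_zero_imp_imp : ∀ x y z : A, i x (i o (i y z)) = i (i y z) x := by
    intro x y z
    grind only [h x o (i y z), zero_imp_imp (i y z) x, zero_imp_zero_imp_imp (i y z) x,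
      zero_imp_zero_imp_imp_imp y z x]
  intro x y z
  grind only [imp_zero_imp_imp z x y, zero_imp_imp x y, h y z (i o x), h z o x,
    imp_zero_imp_imp y x z]

theorem right_comm_of_outer_comm {A : Type*} (i : A → A → A) (o : A)
    (hI : ∀ x y z : A, i (i x y) z = i (i (i (i z o) x) (i (i y z) o)) o)
    (h0 : i (i o o) o = o)
    (h : ∀ x y z : A, i x (i y z) = i z (i y x)) :
    ∀ x y z : A, i (i x y) z = i (i x z) y := by
  have imp_imp_eq : ∀ x y z : A, i (i o (i (i x y) (i (i y o) z))) o = i (i z x) y := by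
    intro x y z
    grind only [h (i (i y o) z) (i x y) o, hI z x y]
  have zero_imp_zz_imp : ∀ x : A, i o (i (i o o) x) = i x o := by
    intro x
    grind only [h x (i o o) o]
  have neg_zero_imp : ∀ x : A, i (i o x) o = i (i x o) o := by
    intro x
    grind only [imp_imp_eq x o o, imp_imp_eq o o x, zero_imp_zz_imp (i (i o o) x),
      imp_imp_eq (i (i o o) x) o o, zero_imp_zz_imp x]
  have neg_zero : i o o = o := by
    grind only [neg_zero_imp (i o o), zero_imp_zz_imp (i o o), h o o (i (i o o) (i o o)),
      imp_imp_eq (i o o) (i o o) o, h (i o (i o o)) o o, h (i o o) o o]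
  have zero_imp_zero_imp : ∀ x : A, i o (i o x) = i x o := by
    intro x
    grind only [zero_imp_zz_imp x]
  have neg_imp_imp : ∀ x y z : A, i (i (i x y) z) o = i (i x y) z := by
    intro x y z
    grind only [imp_imp_eq y z x, h (i y z) (i z o) x, h (i z o) y z,
      neg_zero_imp (i o (i x (i z (i y (i z o))))), zero_imp_zero_imp (i x (i z (i y (i z o)))),
      neg_zero_imp (i x (i z (i y (i z o))))]
  have zero_imp_imp_imp : ∀ x y z : A, i o (i (i x y) z) = i (i x y) z := by
    intro x y z
    grind only [neg_imp_imp x y z, zero_imp_zero_imp (i (i x y) z),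
      zero_imp_zero_imp (i o (i (i x y) z)), neg_zero_imp (i (i x y) z)]
  have zero_imp_neg : ∀ x : A, i o (i x o) = i o x := by
    intro x
    grind only [zero_imp_zero_imp x, zero_imp_zero_imp (i o x), neg_imp_imp o o x]
  have zero_imp_imp_eq : ∀ x y z : A, i o (i x (i y z)) = i (i y z) x := by
    intro x y z
    grind only [h (i y z) x o, zero_imp_imp_imp y z (i x o), zero_imp_zz_imp x,
      h (i y z) o (i (i o o) x), zero_imp_neg (i y z), h (i (i y z) o) o (i (i o o) x),
      h (i (i y z) o) x o, h (i o o) (i y z) x, zero_imp_zz_imp (i (i y z) x),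
      zero_imp_zero_imp (i (i y z) x), zero_imp_neg (i (i y z) x),
      zero_imp_zero_imp (i o (i (i y z) x)), neg_zero_imp (i (i y z) x),
      zero_imp_neg (i (i (i y z) x) o), zero_imp_imp_imp y z x]
  intro x y z
  grind only [zero_imp_imp_eq z x y, h z x y, zero_imp_imp_eq y x z]

/-- Any implication zroupoid satisfying at least one of
    (A2): x → (y → z) ≈ x → (z → y), (A6): x → (y → z) ≈ y → (z → x),
    (A9): x → (y → z) ≈ z → (y → x) satisfies (A11): (x → y) → z ≈ (x → z) → y. -/
theorem stmt_13 {A : Type*} (i : A → A → A) (o : A)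
    (hI : ∀ x y z : A, i (i x y) z = i (i (i (i z o) x) (i (i y z) o)) o)
    (h0 : i (i o o) o = o)
    (h : (∀ x y z : A, i x (i y z) = i x (i z y)) ∨   -- (A2)
         (∀ x y z : A, i x (i y z) = i y (i z x)) ∨   -- (A6)
         (∀ x y z : A, i x (i y z) = i z (i y x))) :  -- (A9)
    ∀ x y z : A, i (i x y) z = i (i x z) y := by
  rcases h with h | h | h
  · exact right_comm_of_inner_comm i o hI h0 h
  · exact right_comm_of_rotate i o hI h0 h
  · exact right_comm_of_outer_comm i o hI h0 h
end

section
/- Let A be an implication zroupoid satisfying the identity (A3): x → (y → z) ≈ (x → z) → y (for all x, y, z in A). Then A satisfies every one of the fourteen identities (A1)–(A14) of associative type of length 3; that is, 𝒜₃ ⊆ 𝒜ⱼ for all 1 ≤ j ≤ 14. -/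
/-- Any implication zroupoid satisfying (A3): x → (y → z) ≈ (x → z) → y
    satisfies all fourteen identities (A1)-(A14); i.e., 𝒜₃ ⊆ 𝒜ⱼ for 1 ≤ j ≤ 14. -/
theorem stmt_14 {A : Type*} (i : A → A → A) (o : A)
    (hI : ∀ x y z : A, i (i x y) z = i (i (i (i z o) x) (i (i y z) o)) o)
    (h0 : i (i o o) o = o)
    (hA3 : ∀ x y z : A, i x (i y z) = i (i x z) y) :
    (∀ x y z : A, i x (i y z) = i (i x y) z) ∧   -- (A1)
    (∀ x y z : A, i x (i y z) = i x (i z y)) ∧   -- (A2)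
    (∀ x y z : A, i x (i y z) = i (i x z) y) ∧   -- (A3)
    (∀ x y z : A, i x (i y z) = i y (i x z)) ∧   -- (A4)
    (∀ x y z : A, i x (i y z) = i (i y x) z) ∧   -- (A5)
    (∀ x y z : A, i x (i y z) = i y (i z x)) ∧   -- (A6)
    (∀ x y z : A, i x (i y z) = i (i y z) x) ∧   -- (A7)
    (∀ x y z : A, i x (i y z) = i (i z x) y) ∧   -- (A8)
    (∀ x y z : A, i x (i y z) = i z (i y x)) ∧   -- (A9)
    (∀ x y z : A, i x (i y z) = i (i z y) x) ∧   -- (A10)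
    (∀ x y z : A, i (i x y) z = i (i x z) y) ∧   -- (A11)
    (∀ x y z : A, i (i x y) z = i (i y x) z) ∧   -- (A12)
    (∀ x y z : A, i (i x y) z = i (i y z) x) ∧   -- (A13)
    (∀ x y z : A, i (i x y) z = i (i z y) x) := by -- (A14)
  have swap_left (x y z : A) : i (i x y) z = i (i y x) z := by
    grind (ematch := 20) (instances := 5000)
  have swap_outer (x y z : A) : i (i x y) z = i (i z y) x := by
    grind (ematch := 20) (instances := 5000)
  have swap_right (x y z : A) : i (i x y) z = i (i x z) y := by
    rw [swap_left, swap_outer, swap_left]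
  clear hI h0
  refine ⟨?_, ?_, ?_, ?_, ?_, ?_, ?_, ?_, ?_, ?_, ?_, ?_, ?_, ?_⟩ <;> grind
end

section
/- Let A be an implication zroupoid satisfying the identities (x → y) → x ≈ x and x → x ≈ 0' (for all x, y in A), i.e., A is a Boolean algebra in the variety ℬ𝒜. Then A satisfies the identity (A4): x → (y → z) ≈ y → (x → z) (for all x, y, z in A); that is, ℬ𝒜 ⊆ 𝒜₄. -/
/-- Left commutativity of a binary operation `j` that distributes over a dual operation `m`,
in the presence of absorption, complements and identity elements. -/
theorem join_left_comm_of_distrib {A : Type*} (j m : A → A → A) (n : A → A) (bot top : A)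
    (m_comm : ∀ x y, m x y = m y x)
    (m_join : ∀ x y z, m x (j y z) = j (m x y) (m x z))
    (m_absorb : ∀ x y, m x (j x y) = x) (j_absorb : ∀ x y, j (m x y) x = x)
    (compl_join : ∀ x, j x (n x) = top) (compl_meet : ∀ x, m (n x) x = bot)
    (bot_join : ∀ x, j bot x = x) (m_top : ∀ x, m x top = x) (a b c : A) :
    j a (j b c) = j b (j a c) := by
  have ext_of_meet : ∀ p q, m a p = m a q → m (n a) p = m (n a) q → p = q := by
    intro p q h₁ h₂
    rw [← m_top p, ← m_top q, ← compl_join a, m_join, m_join, m_comm p, m_comm q,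
      m_comm p, m_comm q, h₁, h₂]
  apply ext_of_meet
  · rw [m_absorb, m_join, m_absorb, j_absorb]
  · simp only [m_join, compl_meet, bot_join]

/-- Any implication zroupoid in ℬ𝒜 (satisfying (x → y) → x ≈ x and
    x → x ≈ 0') satisfies (A4): x → (y → z) ≈ y → (x → z); i.e., ℬ𝒜 ⊆ 𝒜₄. -/
theorem stmt_16 {A : Type*} (i : A → A → A) (o : A)
    (hI : ∀ x y z : A, i (i x y) z = i (i (i (i z o) x) (i (i y z) o)) o)
    (h0 : i (i o o) o = o)
    (hDM : ∀ x y : A, i (i x y) x = x)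
    (hBA : ∀ x : A, i x x = i o o) :
    ∀ x y z : A, i x (i y z) = i y (i x z) := by
  have one_imp : ∀ x, i (i o o) x = x := fun x => by rw [← hBA x, hDM]
  have neg_imp : ∀ x y, i (i x y) o = i (i x (i (i y o) o)) o := fun x y => by
    have h := hI x y o
    rwa [one_imp] at h
  have neg_three : ∀ x, i (i (i x o) o) o = i x o := fun x => by
    have h := neg_imp (i o o) x
    rw [one_imp, one_imp] at h
    exact h.symm
  have neg_neg : ∀ x, i (i x o) o = x := fun x => by
    have h := hI x x x
    rw [hDM] at h
    rw [h, neg_three]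
  have zero_imp : ∀ x, i o x = i o o := fun x => by
    rw [← neg_neg (i o x), hDM]
  have neg_imp_comm : ∀ x y, i (i x o) y = i (i y o) x := fun x y => by
    rw [hI, zero_imp, h0, neg_neg]
  have imp_eq_contra : ∀ x y, i x y = i (i y o) (i x o) := fun x y => by
    rw [← neg_imp_comm, neg_neg]
  have key := join_left_comm_of_distrib (fun x y => i (i x o) y)
    (fun x y => i (i x (i y o)) o) (fun x => i x o) o (i o o)
    (fun x y => by
      show i (i x (i y o)) o = i (i y (i x o)) o
      rw [imp_eq_contra x, neg_neg])
    (fun x y z => by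
      show i (i x (i (i (i y o) z) o)) o =
        i (i (i (i x (i y o)) o) o) (i (i x (i z o)) o)
      rw [neg_neg, imp_eq_contra x, neg_neg, hI (i y o) z (i x o), neg_neg, neg_neg,
        imp_eq_contra z, neg_neg])
    (fun x y => by
      show i (i x (i (i (i x o) y) o)) o = x
      rw [imp_eq_contra x, neg_neg, hDM, neg_neg])
    (fun x y => by
      show i (i (i (i x (i y o)) o) o) x = x
      rw [neg_neg, hDM])
    (fun x => hBA _)
    (fun x => by
      show i (i (i x o) (i x o)) o = o
      rw [hBA, h0])
    one_imp
    (fun x => by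
      show i (i x (i (i o o) o)) o = x
      rw [h0, neg_neg])
  intro x y z
  have h := key (i x o) (i y o) z
  simpa only [neg_neg] using h
end

section
/- Let A be an implication zroupoid satisfying the identity (A11): (x → y) → z ≈ (x → z) → y (for all x, y, z in A). Then A satisfies the identity (A14): (x → y) → z ≈ (z → y) → x (for all x, y, z in A); that is, 𝒜₁₁ ⊆ 𝒜₁₄. -/
/-- Any implication zroupoid satisfying (A11): (x → y) → z ≈ (x → z) → y
    satisfies (A14): (x → y) → z ≈ (z → y) → x; i.e., 𝒜₁₁ ⊆ 𝒜₁₄. -/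
theorem stmt_17 {A : Type*} (i : A → A → A) (o : A)
    (hI : ∀ x y z : A, i (i x y) z = i (i (i (i z o) x) (i (i y z) o)) o)
    (h0 : i (i o o) o = o)
    (hA11 : ∀ x y z : A, i (i x y) z = i (i x z) y) :
    ∀ x y z : A, i (i x y) z = i (i z y) x := by
  have double_eq (x : A) : i (i x o) o = i (i o x) o := by
    rw [hI x o o, h0, hA11 (i o o) x o, h0]
  have triple_eq (x : A) : i (i (i x o) o) o = i o x := by
    rw [double_eq x, hA11 o x o, hA11 (i o o) x o, h0]
  have quad_eq (x : A) : i (i (i (i x o) o) o) o = i (i x o) o := by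
    rw [triple_eq x, double_eq x]
  have swap_triple (x z : A) : i (i x z) o = i (i (i (i z x) o) o) o := by
    rw [hI x z o, hA11 (i (i o o) x), hA11 (i o o), h0, hA11 o x, ← triple_eq, quad_eq z,
      hA11 (i (i z o) o) o x, hA11 (i z o) o x, hA11 z o x]
  have triple_prod (x z : A) : i (i (i (i x z) o) o) o = i (i x z) o := by
    rw [swap_triple x z, quad_eq]
  have comm_neg (x z : A) : i (i x z) o = i (i z x) o := by
    rw [swap_triple x z, triple_prod]
  have double_triple (x y z : A) : i (i (i (i x y) z) o) o = i (i x y) z := by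
    rw [hI x y z, triple_prod]
  have swap_left (x y z : A) : i (i x y) z = i (i y x) z := by
    rw [← double_triple x y z, hA11 (i x y) z o, comm_neg x y, ← hA11 (i y x) z o,
      double_triple]
  intro x y z
  rw [hA11 x y z, swap_left x z y, hA11 z x y]
end

section
/- Let A be a symmetric implication zroupoid (i.e., A satisfies x'' ≈ x and (x → y')' ≈ (y → x')'). Then A satisfies the identity (A11): (x → y) → z ≈ (x → z) → y (for all x, y, z in A) if and only if A satisfies the identities x' ≈ x and x → y ≈ y → x (i.e., A belongs to the variety 𝒮ℒ of semilattices with least element 0); that is, 𝒜₁₁ ∩ 𝒮 = 𝒮ℒ. -/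
/-- A symmetric implication zroupoid satisfies (A11):
    (x → y) → z ≈ (x → z) → y iff it satisfies x' ≈ x and x → y ≈ y → x;
    i.e., 𝒜₁₁ ∩ 𝒮 = 𝒮ℒ. -/
theorem stmt_18 {A : Type*} (i : A → A → A) (o : A)
    (hI : ∀ x y z : A, i (i x y) z = i (i (i (i z o) x) (i (i y z) o)) o)
    (h0 : i (i o o) o = o)
    (hinv : ∀ x : A, i (i x o) o = x)
    (hmc : ∀ x y : A, i (i x (i y o)) o = i (i y (i x o)) o) :
    (∀ x y z : A, i (i x y) z = i (i x z) y) ↔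
      ((∀ x : A, i x o = x) ∧ (∀ x y : A, i x y = i y x)) := by
  constructor
  · intro hA
    have hneg_left : ∀ x y, i (i x o) y = i (i x y) o := fun x y => hA x o y
    have hswap : ∀ x y, i x (i y o) = i y (i x o) := fun x y => by
      rw [← hinv (i x (i y o)), hmc, hinv]
    have hneg_right : ∀ x y, i x (i y o) = i (i x y) o := fun x y => by
      have h := hswap (i y o) x
      rw [hneg_left, hneg_left, hinv] at h
      rw [hswap, ← h, hinv]
    have hcomm : ∀ x y, i x y = i y x := fun x y => by
      have h := hswap x y
      rw [hneg_right, hneg_right] at h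
      rw [← hinv (i x y), h, hinv]
    have hone : ∀ x, i (i o o) x = x := fun x => by
      rw [hneg_left, hcomm o x, hinv]
    have hzero : i o o = o := by
      have h := hI (i o o) (i o o) (i o o)
      simp only [hone, hinv] at h
      rwa [hneg_right, h0] at h
    refine ⟨fun x => ?_, hcomm⟩
    have h := hone x
    rwa [hzero, hcomm] at h
  · rintro ⟨hneg, hcomm⟩ x y z
    have hdist : ∀ x y z, i (i x y) z = i (i x z) (i y z) := fun x y z => by
      have h := hI x y z
      simp only [hneg] at h
      rw [h, hcomm z x]
    have habsorb : ∀ y z, i z (i y z) = i y z := fun y z => by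
      have h := hdist o y z
      rw [hcomm o y, hcomm o z, hneg, hneg] at h
      exact h.symm
    have hassoc : ∀ x y z, i (i x y) z = i x (i y z) := fun x y z => by
      rw [hdist, hdist x z (i y z), habsorb, hcomm _ (i y z), habsorb]
    rw [hassoc, hcomm y z, ← hassoc]
end

section
/- Let A be a symmetric implication zroupoid (i.e., A satisfies x'' ≈ x and (x → y')' ≈ (y → x')') that also satisfies the associative law (A1): x → (y → z) ≈ (x → y) → z (for all x, y, z in A). Then A satisfies the identities x' ≈ x and x → y ≈ y → x, i.e., A belongs to the variety 𝒮ℒ of semilattices with least element 0; that is, 𝒜₁ ∩ 𝒮 ⊆ 𝒮ℒ. -/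
/-- A symmetric implication zroupoid satisfying the associative
    law (A1): x → (y → z) ≈ (x → y) → z satisfies x' ≈ x and x → y ≈ y → x;
    i.e., 𝒜₁ ∩ 𝒮 ⊆ 𝒮ℒ. -/
theorem stmt_19 {A : Type*} (i : A → A → A) (o : A)
    (hI : ∀ x y z : A, i (i x y) z = i (i (i (i z o) x) (i (i y z) o)) o)
    (h0 : i (i o o) o = o)
    (hinv : ∀ x : A, i (i x o) o = x)
    (hmc : ∀ x y : A, i (i x (i y o)) o = i (i y (i x o)) o)
    (hA1 : ∀ x y z : A, i x (i y z) = i (i x y) z) :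
    (∀ x : A, i x o = x) ∧ (∀ x y : A, i x y = i y x) := by
  have hcomm : ∀ x y : A, i x y = i y x := fun x y => by
    have h := hmc x y
    rwa [hA1, hA1, hinv, hinv] at h
  have hoo : i o o = o := by
    have h := hI o o (i o o)
    simp only [h0, hA1] at h
    exact h
  refine ⟨fun x => ?_, hcomm⟩
  calc i x o = i x (i o o) := by rw [hoo]
    _ = x := by rw [hA1, hinv]
end
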